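/- Let Ω ⊆ ℂ be a Denjoy domain with Ω ∩ ℝ = ⋃ (a_n, b_n) and limsup_{n→∞} a_n = ∞. Suppose G : ℝ⁺ → ℝ⁺ is a function with lim_{x→∞} G(x) = 0, and suppose that b_n − a_n ≤ a_n·G(a_n) for every n with a_n > 0. Then neither the Poincaré metric space (Ω, h_Ω) nor the quasihyperbolic metric space (Ω, k_Ω) is Gromov hyperbolic. -/

import Mathlib

open Set Metric Filter Complex

noncomputable section

/-- The length of a curve `γ : [0,1] → E` with respect to the conformal density `ρ`. -/
def curveLen {E : Type*} [NormedAddCommGroup E] [NormedSpace ℝ E]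
    (ρ : E → ℝ) (γ : ℝ → E) : ℝ :=
  ∫ t in (0:ℝ)..1, ρ (γ t) * ‖deriv γ t‖

/-- The distance induced on the set `S` by the conformal density `ρ`, defined as the infimum
of the `ρ`-lengths of C¹ curves joining the two points inside `S`. -/
def densityDist {E : Type*} [NormedAddCommGroup E] [NormedSpace ℝ E]
    (S : Set E) (ρ : E → ℝ) (z w : E) : ℝ :=
  sInf { L | ∃ γ : ℝ → E, ContDiffOn ℝ 1 γ (Icc 0 1) ∧ γ 0 = z ∧ γ 1 = w ∧
      (∀ t ∈ Icc (0:ℝ) 1, γ t ∈ S) ∧ L = curveLen ρ γ }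

/-- The quasihyperbolic density `1/δ_Ω(z)` of a domain `Ω`. -/
def qhDensity {E : Type*} [NormedAddCommGroup E] [NormedSpace ℝ E] (Ω : Set E) : E → ℝ :=
  fun z => (Metric.infDist z Ωᶜ)⁻¹

/-- The quasihyperbolic distance of a domain `Ω`. -/
def qhDist {E : Type*} [NormedAddCommGroup E] [NormedSpace ℝ E] (Ω : Set E) : E → E → ℝ :=
  densityDist Ω (qhDensity Ω)

/-- `lam` is the density of the Poincaré (hyperbolic) metric of the plane domain `Ω`:
it is the pushforward of the density `2/(1-|z|²)` of the unit disk under a holomorphic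
universal covering map `p : 𝔻 → Ω`. -/
def IsPoincareDensity (Ω : Set ℂ) (lam : ℂ → ℝ) : Prop :=
  ∃ p : ℂ → ℂ,
    (∀ z ∈ ball (0:ℂ) 1, DifferentiableAt ℂ p z) ∧
    p '' ball (0:ℂ) 1 = Ω ∧
    IsCoveringMapOn (fun z : ball (0:ℂ) 1 => p z) Ω ∧
    ∀ z ∈ ball (0:ℂ) 1, lam (p z) * ‖deriv p z‖ = 2 / (1 - ‖z‖ ^ 2)

/-- `g` is a geodesic in `(S, d)` from `x` to `y`, parametrized by arclength on
`[0, d x y]`. -/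
def IsGeodesicIn {α : Type*} (S : Set α) (d : α → α → ℝ) (g : ℝ → α) (x y : α) : Prop :=
  g 0 = x ∧ g (d x y) = y ∧ (∀ t ∈ Icc (0:ℝ) (d x y), g t ∈ S) ∧
  ∀ s ∈ Icc (0:ℝ) (d x y), ∀ t ∈ Icc (0:ℝ) (d x y), d (g s) (g t) = |s - t|

/-- Every geodesic triangle of `(S, d)` is `δ`-thin (Rips condition). -/
def GromovHyperbolicWith {α : Type*} (S : Set α) (d : α → α → ℝ) (δ : ℝ) : Prop :=
  ∀ x ∈ S, ∀ y ∈ S, ∀ z ∈ S, ∀ gxy gxz gzy : ℝ → α,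
    IsGeodesicIn S d gxy x y → IsGeodesicIn S d gxz x z → IsGeodesicIn S d gzy z y →
    ∀ t ∈ Icc (0:ℝ) (d x y),
      ∃ p ∈ gxz '' Icc (0:ℝ) (d x z) ∪ gzy '' Icc (0:ℝ) (d z y), d (gxy t) p ≤ δ

/-- `(S, d)` is Gromov hyperbolic: some `δ ≥ 0` works for all geodesic triangles. -/
def IsGromovHyperbolic {α : Type*} (S : Set α) (d : α → α → ℝ) : Prop :=
  ∃ δ : ℝ, 0 ≤ δ ∧ GromovHyperbolicWith S d δ

/-- The real axis inside `ℂ`. -/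
def realLine : Set ℂ := {z : ℂ | z.im = 0}

/-- A Denjoy domain: a domain whose boundary is contained in the real axis. -/
def IsDenjoyDomain (Ω : Set ℂ) : Prop :=
  IsOpen Ω ∧ IsConnected Ω ∧ frontier Ω ⊆ realLine

/-- The distance (for the distance function `d`) from a point to a set. -/
def distToSet {α : Type*} (d : α → α → ℝ) (z : α) (A : Set α) : ℝ :=
  sInf (d z '' A)

/-- A fundamental geodesic: a geodesic of `(S, d)` contained in the closed upper half plane,
joining a point of the boundary interval `I` (on the real axis) to a point of the boundary
interval `J`. -/
def IsFundGeodesic (S : Set ℂ) (d : ℂ → ℂ → ℝ) (I J : Set ℝ) (g : ℝ → ℂ) (x y : ℂ) : Prop :=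
  IsGeodesicIn S d g x y ∧ x.im = 0 ∧ x.re ∈ I ∧ y.im = 0 ∧ y.re ∈ J ∧
  ∀ t ∈ Icc (0:ℝ) (d x y), 0 ≤ (g t).im

end

noncomputable section

open scoped Topology

section LengthMetric

variable {E : Type*} [NormedAddCommGroup E] [NormedSpace ℝ E]

/-- A globally defined C¹ path in `S` that rests at `z` before time `0` and at `w` after
time `1`. -/
structure IsSmoothPath (S : Set E) (γ : ℝ → E) (z w : E) : Prop where
  contDiff : ContDiff ℝ 1 γ
  mem : ∀ t, γ t ∈ S
  source : ∀ t ≤ 0, γ t = z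
  target : ∀ t, 1 ≤ t → γ t = w

variable {S : Set E} {ρ : E → ℝ} {x y z w : E} {γ : ℝ → E}

lemma ContDiff.continuous_speed (hγ : ContDiff ℝ 1 γ) (hS : ∀ t, γ t ∈ S)
    (hρ : ContinuousOn ρ S) : Continuous fun t => ρ (γ t) * ‖deriv γ t‖ :=
  (hρ.comp_continuous hγ.continuous hS).mul (hγ.continuous_deriv le_rfl).norm

lemma IsSmoothPath.continuous_speed (hγ : IsSmoothPath S γ x y) (hρ : ContinuousOn ρ S) :
    Continuous fun t => ρ (γ t) * ‖deriv γ t‖ :=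
  hγ.contDiff.continuous_speed hγ.mem hρ

lemma curveLen_nonneg (hpos : ∀ z ∈ S, 0 < ρ z) (hS : ∀ t ∈ Icc (0:ℝ) 1, γ t ∈ S) :
    0 ≤ curveLen ρ γ :=
  intervalIntegral.integral_nonneg zero_le_one fun t ht =>
    mul_nonneg (hpos _ (hS t ht)).le (norm_nonneg _)

lemma curveLen_bddBelow (hpos : ∀ z ∈ S, 0 < ρ z) :
    BddBelow { L | ∃ γ : ℝ → E, ContDiffOn ℝ 1 γ (Icc 0 1) ∧ γ 0 = z ∧ γ 1 = w ∧
      (∀ t ∈ Icc (0:ℝ) 1, γ t ∈ S) ∧ L = curveLen ρ γ } :=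
  ⟨0, by rintro _ ⟨γ, -, -, -, h, rfl⟩; exact curveLen_nonneg hpos h⟩

lemma densityDist_nonneg (hpos : ∀ z ∈ S, 0 < ρ z) : 0 ≤ densityDist S ρ z w :=
  Real.sInf_nonneg (by rintro _ ⟨γ, -, -, -, h, rfl⟩; exact curveLen_nonneg hpos h)

lemma densityDist_le_curveLen (hpos : ∀ z ∈ S, 0 < ρ z) (hγ : ContDiffOn ℝ 1 γ (Icc 0 1))
    (h0 : γ 0 = z) (h1 : γ 1 = w) (hS : ∀ t ∈ Icc (0:ℝ) 1, γ t ∈ S) :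
    densityDist S ρ z w ≤ curveLen ρ γ :=
  csInf_le (curveLen_bddBelow hpos) ⟨γ, hγ, h0, h1, hS, rfl⟩

lemma IsSmoothPath.densityDist_le (hpos : ∀ z ∈ S, 0 < ρ z) (hγ : IsSmoothPath S γ z w) :
    densityDist S ρ z w ≤ curveLen ρ γ :=
  densityDist_le_curveLen hpos hγ.contDiff.contDiffOn (hγ.source 0 le_rfl) (hγ.target 1 le_rfl)
    fun t _ => hγ.mem t

/-- Slowing a C¹ curve down at its endpoints makes it globally C¹ without changing its length. -/
lemma exists_isSmoothPath_of_contDiffOn (hρ : ContinuousOn ρ S) (hγ : ContDiffOn ℝ 1 γ (Icc 0 1))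
    (h0 : γ 0 = z) (h1 : γ 1 = w) (hS : ∀ t ∈ Icc (0:ℝ) 1, γ t ∈ S) :
    ∃ γ', IsSmoothPath S γ' z w ∧ curveLen ρ γ' = curveLen ρ γ := by
  set φ := Real.smoothTransition
  have hφ : ContDiff ℝ 1 φ := Real.smoothTransition.contDiff (n := 1)
  have hφm : ∀ t, φ t ∈ Icc (0:ℝ) 1 := fun t =>
    ⟨Real.smoothTransition.nonneg t, Real.smoothTransition.le_one t⟩
  have hφd : ∀ t, HasDerivAt φ (deriv φ t) t := fun t =>
    (hφ.differentiable (by norm_num) t).hasDerivAt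
  refine ⟨γ ∘ φ, ⟨contDiffOn_univ.1 (hγ.comp hφ.contDiffOn fun t _ => hφm t),
    fun t => hS _ (hφm t), fun t ht => ?_, fun t ht => ?_⟩, ?_⟩
  · simp [φ, Real.smoothTransition.zero_of_nonpos ht, h0]
  · simp [φ, Real.smoothTransition.one_of_one_le ht, h1]
  set f : ℝ → ℝ := fun u => ρ (γ u) * ‖derivWithin γ (Icc 0 1) u‖
  have hf : ContinuousOn f (Icc 0 1) :=
    (hρ.comp hγ.continuousOn hS).mul
      (hγ.continuousOn_derivWithin (uniqueDiffOn_Icc zero_lt_one) le_rfl).norm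
  have e1 : curveLen ρ γ = ∫ u in (0:ℝ)..1, f u := by
    unfold curveLen
    refine intervalIntegral.integral_congr_ae' ?_ (by simp)
    have : ∀ᵐ t : ℝ, t ≠ 1 := by simp [MeasureTheory.ae_iff]
    filter_upwards [this] with t ht1 ht
    simp only [f]
    rw [derivWithin_of_mem_nhds (Icc_mem_nhds ht.1 (lt_of_le_of_ne ht.2 ht1))]
  have e2 : ∀ t, ρ ((γ ∘ φ) t) * ‖deriv (γ ∘ φ) t‖ = (f ∘ φ) t * deriv φ t := by
    intro t
    have hd : HasDerivWithinAt γ (derivWithin γ (Icc 0 1) (φ t)) (Icc 0 1) (φ t) :=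
      (hγ.differentiableOn (by norm_num) _ (hφm t)).hasDerivWithinAt
    have : HasDerivAt (γ ∘ φ) (deriv φ t • derivWithin γ (Icc 0 1) (φ t)) t := by
      have := hd.scomp t (hφd t).hasDerivWithinAt (s := univ) (fun u _ => hφm u)
      simpa using this
    rw [this.deriv, norm_smul, Real.norm_of_nonneg
      (Real.smoothTransition.monotone.deriv_nonneg)]
    simp only [f, Function.comp]
    ring
  rw [e1, curveLen]
  simp_rw [e2]
  rw [intervalIntegral.integral_comp_mul_deriv'' hφ.continuous.continuousOn
    (fun t _ => (hφd t).hasDerivWithinAt) (hφ.continuous_deriv le_rfl).continuousOn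
    (hf.mono (by rintro _ ⟨t, -, rfl⟩; exact hφm t))]
  simp [φ]

/-- Any two points of `S` are joined by a smooth path. -/
def SmoothlyConnected (S : Set E) : Prop :=
  ∀ z ∈ S, ∀ w ∈ S, ∃ γ, IsSmoothPath S γ z w

lemma exists_isSmoothPath_lt (hρ : ContinuousOn ρ S) (hpos : ∀ z ∈ S, 0 < ρ z) (hc : SmoothlyConnected S)
    (hz : z ∈ S)
    (hw : w ∈ S) {r : ℝ} (hr : densityDist S ρ z w < r) :
    ∃ γ, IsSmoothPath S γ z w ∧ curveLen ρ γ < r := by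
  obtain ⟨γ₀, h₀⟩ := hc z hz w hw
  unfold densityDist at hr
  obtain ⟨_, ⟨γ, h1, h2, h3, h4, rfl⟩, hlt⟩ := (csInf_lt_iff (curveLen_bddBelow hpos)
    ⟨_, γ₀, h₀.contDiff.contDiffOn, h₀.source 0 le_rfl, h₀.target 1 le_rfl,
      fun t _ => h₀.mem t, rfl⟩).1 hr
  obtain ⟨γ', h, e⟩ := exists_isSmoothPath_of_contDiffOn hρ h1 h2 h3 h4
  exact ⟨γ', h, e ▸ hlt⟩

/-- Subcurves of a C¹ curve bound the distance of their endpoints. -/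
lemma densityDist_le_integral (hpos : ∀ z ∈ S, 0 < ρ z) (hγ : ContDiff ℝ 1 γ)
    (hS : ∀ t, γ t ∈ S) {a b : ℝ} (hab : a ≤ b) :
    densityDist S ρ (γ a) (γ b) ≤ ∫ t in a..b, ρ (γ t) * ‖deriv γ t‖ := by
  have h := densityDist_le_curveLen (ρ := ρ) (γ := fun t => γ (a + (b - a) * t)) hpos
    (z := γ a) (w := γ b) (hγ.comp (by fun_prop)).contDiffOn (by simp) (by simp) (fun t _ => hS _)
  refine h.trans_eq ?_
  unfold curveLen
  have e : ∀ t, deriv (fun t => γ (a + (b - a) * t)) t = (b - a) • deriv γ (a + (b - a) * t) := by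
    intro t
    have h1 : HasDerivAt (fun t : ℝ => a + (b - a) * t) (b - a) t := by
      simpa using ((hasDerivAt_id t).const_mul (b - a)).const_add a
    exact (((hγ.differentiable (by norm_num) _).hasDerivAt).scomp t h1).deriv
  simp_rw [e, norm_smul, Real.norm_of_nonneg (sub_nonneg.2 hab)]
  have := intervalIntegral.smul_integral_comp_add_mul (a := 0) (b := 1)
    (fun t => ρ (γ t) * ‖deriv γ t‖) (b - a) a
  rw [smul_eq_mul, ← intervalIntegral.integral_const_mul] at this
  simp only [mul_zero, add_zero, mul_one, add_sub_cancel] at this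
  rw [← this]
  congr 1; ext t; ring

lemma IsSmoothPath.trans (hρ : ContinuousOn ρ S) {γ₁ γ₂ : ℝ → E} (h₁ : IsSmoothPath S γ₁ x y)
    (h₂ : IsSmoothPath S γ₂ y z) :
    ∃ γ, IsSmoothPath S γ x z ∧ curveLen ρ γ = curveLen ρ γ₁ + curveLen ρ γ₂ := by
  set γ : ℝ → E := fun t => γ₁ (2 * t) + γ₂ (2 * t - 1) - y with hγ
  have l : ∀ t ≤ (1/2 : ℝ), γ t = γ₁ (2 * t) := fun t ht => by
    simp [hγ, h₂.source (2 * t - 1) (by linarith)]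
  have r : ∀ t, (1/2 : ℝ) ≤ t → γ t = γ₂ (2 * t - 1) := fun t ht => by
    simp [hγ, h₁.target (2 * t) (by linarith)]
  have hcd : ContDiff ℝ 1 γ :=
    ((h₁.contDiff.comp (by fun_prop)).add (h₂.contDiff.comp (by fun_prop))).sub contDiff_const
  have hmem : ∀ t, γ t ∈ S := fun t => by
    rcases le_total t (1/2) with h | h
    · rw [l t h]; exact h₁.mem _
    · rw [r t h]; exact h₂.mem _
  have hp : IsSmoothPath S γ x z := ⟨hcd, hmem,
    fun t ht => by rw [l t (by linarith), h₁.source _ (by linarith)],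
    fun t ht => by rw [r t (by linarith), h₂.target _ (by linarith)]⟩
  refine ⟨γ, hp, ?_⟩
  have hi : ∀ a b, IntervalIntegrable (fun t => ρ (γ t) * ‖deriv γ t‖) MeasureTheory.volume a b :=
    fun a b => (hp.continuous_speed hρ).intervalIntegrable a b
  unfold curveLen
  rw [← intervalIntegral.integral_add_adjacent_intervals (hi 0 (1/2)) (hi (1/2) 1)]
  have hae : ∀ᵐ t : ℝ, t ≠ 1/2 := by simp [MeasureTheory.ae_iff]
  congr 1
  · have := intervalIntegral.smul_integral_comp_mul_left (a := 0) (b := 1/2)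
      (fun t => ρ (γ₁ t) * ‖deriv γ₁ t‖) 2
    rw [smul_eq_mul, ← intervalIntegral.integral_const_mul] at this
    norm_num only [mul_zero] at this
    rw [← this]
    refine intervalIntegral.integral_congr_ae' ?_ (by norm_num)
    filter_upwards [hae] with t ht1 ht
    have hlt := lt_of_le_of_ne ht.2 ht1
    have : γ =ᶠ[𝓝 t] fun t => γ₁ (2 * t) := by
      filter_upwards [Iio_mem_nhds hlt] with s hs using l s hs.le
    rw [this.deriv_eq, l t ht.2, deriv_comp_mul_left, norm_smul]
    norm_num
    ring
  · have := intervalIntegral.smul_integral_comp_mul_sub (a := 1/2) (b := 1)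
      (fun t => ρ (γ₂ t) * ‖deriv γ₂ t‖) 2 1
    rw [smul_eq_mul, ← intervalIntegral.integral_const_mul] at this
    norm_num only at this
    rw [← this]
    refine intervalIntegral.integral_congr_ae' ?_ (by norm_num)
    refine Eventually.of_forall fun t ht => ?_
    have : γ =ᶠ[𝓝 t] fun t => γ₂ (2 * t - 1) := by
      filter_upwards [Ioi_mem_nhds ht.1] with s hs using r s (le_of_lt hs)
    have hd : HasDerivAt (fun t => γ₂ (2 * t - 1)) ((2:ℝ) • deriv γ₂ (2 * t - 1)) t := by
      have h1 : HasDerivAt (fun t : ℝ => 2 * t - 1) 2 t := by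
        simpa using ((hasDerivAt_id t).const_mul (2:ℝ)).sub_const 1
      exact ((h₂.contDiff.differentiable (by norm_num) _).hasDerivAt).scomp t h1
    rw [this.deriv_eq, r t ht.1.le, hd.deriv, norm_smul]
    norm_num
    ring

lemma IsSmoothPath.symm (h : IsSmoothPath S γ x y) :
    IsSmoothPath S (fun t => γ (1 - t)) y x :=
  ⟨h.contDiff.comp (by fun_prop), fun t => h.mem _, fun t ht => h.target _ (by linarith),
    fun t ht => h.source _ (by linarith)⟩

lemma curveLen_symm : curveLen ρ (fun t => γ (1 - t)) = curveLen ρ γ := by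
  unfold curveLen
  have := intervalIntegral.integral_comp_sub_left (a := 0) (b := 1)
    (fun t => ρ (γ t) * ‖deriv γ t‖) 1
  simp only [sub_self, sub_zero] at this
  rw [← this]
  simp [deriv_comp_const_sub]

lemma densityDist_triangle (hρ : ContinuousOn ρ S) (hpos : ∀ z ∈ S, 0 < ρ z)
    (hc : SmoothlyConnected S) (hx : x ∈ S) (hy : y ∈ S) (hz : z ∈ S) :
    densityDist S ρ x z ≤ densityDist S ρ x y + densityDist S ρ y z := by
  refine le_of_forall_pos_le_add fun ε hε => ?_
  obtain ⟨γ₁, h₁, l₁⟩ := exists_isSmoothPath_lt hρ hpos hc hx hy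
    (lt_add_of_pos_right (densityDist S ρ x y) (half_pos hε))
  obtain ⟨γ₂, h₂, l₂⟩ := exists_isSmoothPath_lt hρ hpos hc hy hz
    (lt_add_of_pos_right (densityDist S ρ y z) (half_pos hε))
  obtain ⟨γ, h, l⟩ := h₁.trans hρ h₂
  have := h.densityDist_le hpos
  linarith

lemma densityDist_comm (hρ : ContinuousOn ρ S) (hpos : ∀ z ∈ S, 0 < ρ z)
    (hc : SmoothlyConnected S) (hx : x ∈ S) (hy : y ∈ S) :
    densityDist S ρ x y = densityDist S ρ y x := by
  have key : ∀ x ∈ S, ∀ y ∈ S, densityDist S ρ x y ≤ densityDist S ρ y x := by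
    intro x hx y hy
    refine le_of_forall_pos_le_add fun ε hε => ?_
    obtain ⟨γ₁, h₁, l₁⟩ := exists_isSmoothPath_lt hρ hpos hc hy hx
      (lt_add_of_pos_right (densityDist S ρ y x) hε)
    have := h₁.symm.densityDist_le hpos
    rw [curveLen_symm] at this
    linarith
  exact le_antisymm (key x hx y hy) (key y hy x hx)

lemma densityDist_self (hpos : ∀ z ∈ S, 0 < ρ z) (hx : x ∈ S) : densityDist S ρ x x = 0 := by
  refine le_antisymm ?_ (densityDist_nonneg hpos)
  have := densityDist_le_curveLen (γ := fun _ => x) hpos contDiffOn_const rfl rfl (fun _ _ => hx)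
  simpa [curveLen] using this

/-- A straight segment bounds the distance of its endpoints. -/
lemma densityDist_le_of_segment (hρ : ContinuousOn ρ S) (hpos : ∀ z ∈ S, 0 < ρ z) {v : E}
    {f : ℝ → ℝ} (hf : ContinuousOn f (Icc 0 1)) (hS : ∀ t ∈ Icc (0:ℝ) 1, x + t • v ∈ S)
    (hle : ∀ t ∈ Icc (0:ℝ) 1, ρ (x + t • v) * ‖v‖ ≤ f t) :
    densityDist S ρ x (x + v) ≤ ∫ t in (0:ℝ)..1, f t := by
  have hd : ∀ t : ℝ, deriv (fun t : ℝ => x + t • v) t = v := fun t => by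
    simpa using (((hasDerivAt_id t).smul_const v).const_add x).deriv
  have h := densityDist_le_curveLen (γ := fun t : ℝ => x + t • v) hpos
    (by fun_prop : ContDiff ℝ 1 (fun t : ℝ => x + t • v)).contDiffOn (by simp) (by simp) hS
    (z := x) (w := x + v)
  refine h.trans ?_
  unfold curveLen
  refine intervalIntegral.integral_mono_on zero_le_one ?_ ?_ ?_
  · simp_rw [hd]
    refine (ContinuousOn.mul ?_ continuousOn_const).intervalIntegrable
    rw [uIcc_of_le zero_le_one]
    exact hρ.comp (by fun_prop) hS
  · refine ContinuousOn.intervalIntegrable ?_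
    rwa [uIcc_of_le zero_le_one]
  · intro t ht
    rw [hd]; exact hle t ht

lemma densityDist_le_mul_norm (hρ : ContinuousOn ρ S) (hpos : ∀ z ∈ S, 0 < ρ z) {v : E} {C : ℝ}
    (hS : ∀ t ∈ Icc (0:ℝ) 1, x + t • v ∈ S) (hle : ∀ t ∈ Icc (0:ℝ) 1, ρ (x + t • v) ≤ C) :
    densityDist S ρ x (x + v) ≤ C * ‖v‖ := by
  have := densityDist_le_of_segment hρ hpos (f := fun _ => C * ‖v‖) continuousOn_const hS
    (fun t ht => mul_le_mul_of_nonneg_right (hle t ht) (norm_nonneg _))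
  simpa using this

lemma smoothlyConnected_of_isOpen (hS : IsOpen S) (hc : IsPreconnected S) :
    SmoothlyConnected S := by
  have hρ : ContinuousOn (fun _ : E => (1:ℝ)) S := continuousOn_const
  intro z hz w hw
  refine hc.induction₂' (fun z w => z ∈ S → w ∈ S → ∃ γ, IsSmoothPath S γ z w) ?_ ?_ hz hw hz hw
  · intro x hx
    obtain ⟨r, hr, hb⟩ := Metric.isOpen_iff.1 hS x hx
    filter_upwards [mem_nhdsWithin_of_mem_nhds (ball_mem_nhds x hr)] with y hy
    have hseg : ∀ t ∈ Icc (0:ℝ) 1, x + t • (y - x) ∈ S := fun t ht =>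
      hb ((convex_ball x r).add_smul_sub_mem (mem_ball_self hr) hy ht)
    have h : ∃ γ, IsSmoothPath S γ x y := by
      obtain ⟨γ, h, -⟩ := exists_isSmoothPath_of_contDiffOn (γ := fun t : ℝ => x + t • (y - x)) hρ
        (by fun_prop : ContDiff ℝ 1 (fun t : ℝ => x + t • (y - x))).contDiffOn rfl rfl hseg
      exact ⟨γ, by simpa using h⟩
    exact ⟨fun _ _ => h, fun _ _ => ⟨_, h.choose_spec.symm⟩⟩
  · intro x y z hx hy hz h₁ h₂ hx' hz'
    obtain ⟨γ₁, k₁⟩ := h₁ hx hy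
    obtain ⟨γ₂, k₂⟩ := h₂ hy hz
    obtain ⟨γ, k, -⟩ := k₁.trans hρ k₂
    exact ⟨γ, k⟩

end LengthMetric

section LengthSpace

variable {E : Type*} [NormedAddCommGroup E] [NormedSpace ℝ E]

/-- A positive continuous density on a connected open set. -/
structure IsAdmissibleDensity (S : Set E) (ρ : E → ℝ) : Prop where
  isOpen : IsOpen S
  isPreconnected : IsPreconnected S
  continuousOn : ContinuousOn ρ S
  pos : ∀ z ∈ S, 0 < ρ z

variable {S : Set E} {ρ : E → ℝ} {x y z w : E} {γ : ℝ → E}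

namespace IsAdmissibleDensity

lemma smoothlyConnected (h : IsAdmissibleDensity S ρ) : SmoothlyConnected S :=
  smoothlyConnected_of_isOpen h.isOpen h.isPreconnected

lemma nonneg (h : IsAdmissibleDensity S ρ) : 0 ≤ densityDist S ρ x y :=
  densityDist_nonneg h.pos

lemma triangle (h : IsAdmissibleDensity S ρ) (hx : x ∈ S) (hy : y ∈ S) (hz : z ∈ S) :
    densityDist S ρ x z ≤ densityDist S ρ x y + densityDist S ρ y z :=
  densityDist_triangle h.continuousOn h.pos h.smoothlyConnected hx hy hz

lemma comm (h : IsAdmissibleDensity S ρ) (hx : x ∈ S) (hy : y ∈ S) :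
    densityDist S ρ x y = densityDist S ρ y x :=
  densityDist_comm h.continuousOn h.pos h.smoothlyConnected hx hy

lemma exists_path_lt (h : IsAdmissibleDensity S ρ) (hx : x ∈ S) (hy : y ∈ S) {r : ℝ}
    (hr : densityDist S ρ x y < r) : ∃ γ, IsSmoothPath S γ x y ∧ curveLen ρ γ < r :=
  exists_isSmoothPath_lt h.continuousOn h.pos h.smoothlyConnected hx hy hr

/-- A function whose pointwise Lipschitz constant is at most `ρ` is `1`-Lipschitz for the distance
induced by `ρ`. -/
lemma abs_sub_le (h : IsAdmissibleDensity S ρ) {F : E → ℝ}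
    (hF : ∀ w ∈ S, ∀ κ > ρ w, ∀ᶠ u in 𝓝 w, |F u - F w| ≤ κ * ‖u - w‖) (hx : x ∈ S) (hy : y ∈ S) :
    |F x - F y| ≤ densityDist S ρ x y := by
  have hcont : ∀ w ∈ S, ContinuousAt F w := by
    intro w hw
    rw [ContinuousAt, tendsto_iff_norm_sub_tendsto_zero]
    refine squeeze_zero' (Eventually.of_forall fun _ => norm_nonneg _)
      (hF w hw (ρ w + 1) (by linarith)) ?_
    have : Tendsto (fun u => (ρ w + 1) * ‖u - w‖) (𝓝 w) (𝓝 ((ρ w + 1) * ‖w - w‖)) :=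
      (by fun_prop : Continuous fun u => (ρ w + 1) * ‖u - w‖).tendsto w
    simpa using this
  have key : ∀ x ∈ S, ∀ y ∈ S, F y - F x ≤ densityDist S ρ x y := by
    intro x hx y hy
    refine le_of_forall_pos_le_add fun ε hε => ?_
    obtain ⟨γ, hγ, hl⟩ := h.exists_path_lt hx hy (lt_add_of_pos_right (densityDist S ρ x y) hε)
    have hsp := hγ.continuous_speed h.continuousOn
    have hB : ∀ t, HasDerivAt (fun t => F x + ∫ s in (0:ℝ)..t, ρ (γ s) * ‖deriv γ s‖)
        (ρ (γ t) * ‖deriv γ t‖) t := fun t =>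
      (hsp.integral_hasStrictDerivAt 0 t).hasDerivAt.const_add _
    have := image_le_of_liminf_slope_right_le_deriv_boundary (f := fun t => F (γ t)) (a := 0)
      (b := 1)
      (fun t _ => ((hcont _ (hγ.mem t)).comp
        hγ.contDiff.continuous.continuousAt).continuousWithinAt)
      (B := fun t => F x + ∫ s in (0:ℝ)..t, ρ (γ s) * ‖deriv γ s‖)
      (by simp [hγ.source 0 le_rfl]) (fun t _ => (hB t).continuousAt.continuousWithinAt)
      (fun t _ => (hB t).hasDerivWithinAt) ?_ (right_mem_Icc.2 zero_le_one)
    · simp only [hγ.target 1 le_rfl] at this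
      unfold curveLen at hl
      linarith
    · intro t _ r hr
      obtain ⟨η, hη, hlt⟩ : ∃ η > 0, (ρ (γ t) + η) * (‖deriv γ t‖ + η) < r := by
        have : ∀ᶠ η : ℝ in 𝓝[>] 0, (ρ (γ t) + η) * (‖deriv γ t‖ + η) < r := by
          refine mem_nhdsWithin_of_mem_nhds ?_
          have hc : Continuous fun η : ℝ => (ρ (γ t) + η) * (‖deriv γ t‖ + η) := by fun_prop
          exact hc.continuousAt.eventually_lt_const (by simpa using hr)
        obtain ⟨η, h1, h2⟩ := (this.and self_mem_nhdsWithin).exists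
        exact ⟨η, h2, h1⟩
      have hd : HasDerivWithinAt γ (deriv γ t) (Ioi t) t :=
        (hγ.contDiff.differentiable (by norm_num) t).hasDerivAt.hasDerivWithinAt
      have e1 := hd.limsup_norm_slope_le (lt_add_of_pos_right ‖deriv γ t‖ hη)
      have e2 := (hγ.contDiff.continuous.continuousAt (x := t)).eventually
        (hF _ (hγ.mem t) _ (lt_add_of_pos_right (ρ (γ t)) hη))
      refine Eventually.frequently ?_
      filter_upwards [e1, mem_nhdsWithin_of_mem_nhds e2, self_mem_nhdsWithin] with s h1 h2 h3
      have hs : 0 < s - t := sub_pos.2 h3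
      rw [Real.norm_of_nonneg hs.le, inv_mul_lt_iff₀ hs] at h1
      rw [slope_def_field, div_lt_iff₀ hs]
      have hp := h.pos _ (hγ.mem t)
      calc F (γ s) - F (γ t) ≤ (ρ (γ t) + η) * ‖γ s - γ t‖ := (le_abs_self _).trans h2
        _ ≤ (ρ (γ t) + η) * ((s - t) * (‖deriv γ t‖ + η)) := by gcongr
        _ = ((ρ (γ t) + η) * (‖deriv γ t‖ + η)) * (s - t) := by ring
        _ < r * (s - t) := by gcongr
  rw [abs_le]
  have h1 := key x hx y hy
  have h2 := key y hy x hx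
  rw [← h.comm hx hy] at h2
  constructor <;> linarith

/-- A lower bound of the density on a ball gives a lower bound of the distance to its center. -/
lemma mul_min_le (h : IsAdmissibleDensity S ρ) {κ r : ℝ} (hκ : 0 ≤ κ)
    (hle : ∀ u ∈ S, ‖u - w‖ ≤ r → κ ≤ ρ u) (hw : w ∈ S) (hx : x ∈ S) (hr : 0 ≤ r) :
    κ * min r ‖x - w‖ ≤ densityDist S ρ w x := by
  have := h.abs_sub_le (F := fun u => κ * min r ‖u - w‖) ?_ hx hw
  · rw [h.comm hx hw] at this
    simp only [sub_self, norm_zero, min_eq_right hr, mul_zero, sub_zero] at this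
    exact (le_abs_self _).trans this
  · intro u hu κ' hκ'
    rcases le_or_gt ‖u - w‖ r with hur | hur
    · refine Eventually.of_forall fun v => ?_
      rw [← mul_sub, abs_mul, abs_of_nonneg hκ]
      have h1 : |min r ‖v - w‖ - min r ‖u - w‖| ≤ ‖v - u‖ := by
        have e := abs_norm_sub_norm_le (v - w) (u - w)
        rw [sub_sub_sub_cancel_right] at e
        refine (abs_min_sub_min_le_max r _ r _).trans ?_
        simp [e]
      have h2 := (hle u hu hur).trans hκ'.le
      exact mul_le_mul h2 h1 (abs_nonneg _) (hκ.trans h2)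
    · have : ∀ᶠ v in 𝓝 u, r < ‖v - w‖ :=
        (by fun_prop : Continuous fun v => ‖v - w‖).continuousAt.eventually_const_lt hur
      filter_upwards [this] with v hv
      rw [min_eq_left hv.le, min_eq_left hur.le, sub_self, abs_zero]
      exact mul_nonneg ((h.pos u hu).le.trans hκ'.le) (norm_nonneg _)

lemma exists_mul_min_le (h : IsAdmissibleDensity S ρ) (hw : w ∈ S) {κ : ℝ} (hκ : 0 ≤ κ)
    (hlt : κ < ρ w) : ∃ r > 0, ∀ x ∈ S, κ * min r ‖x - w‖ ≤ densityDist S ρ w x := by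
  have := (h.continuousOn.continuousAt (h.isOpen.mem_nhds hw)).eventually_const_lt hlt
  obtain ⟨r, hr, hb⟩ := Metric.eventually_nhds_iff_ball.1 this
  refine ⟨r / 2, half_pos hr, fun x hx => h.mul_min_le hκ (fun u _ hu => (hb u ?_).le) hw hx
    (half_pos hr).le⟩
  rw [mem_ball_iff_norm]; linarith

lemma eq_of_densityDist_le_zero (h : IsAdmissibleDensity S ρ) (hx : x ∈ S) (hy : y ∈ S)
    (h0 : densityDist S ρ x y ≤ 0) : y = x := by
  have hp := h.pos x hx
  obtain ⟨r, hr, hb⟩ := h.exists_mul_min_le hx (half_pos hp).le (half_lt_self hp)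
  by_contra hne
  have : 0 < ‖y - x‖ := norm_pos_iff.2 (sub_ne_zero.2 hne)
  have h1 := (hb y hy).trans h0
  have h2 : 0 < ρ x / 2 * min r ‖y - x‖ := mul_pos (half_pos hp) (lt_min hr this)
  linarith

lemma tendsto_zero (h : IsAdmissibleDensity S ρ) (hw : w ∈ S) :
    Tendsto (fun u => densityDist S ρ w u) (𝓝 w) (𝓝 0) := by
  have h1 := (h.continuousOn.continuousAt (h.isOpen.mem_nhds hw)).eventually_lt_const
    (lt_add_one (ρ w))
  obtain ⟨r, hr, hb⟩ := Metric.eventually_nhds_iff_ball.1 (h1.and (h.isOpen.mem_nhds hw))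
  have : Tendsto (fun u => (ρ w + 1) * ‖u - w‖) (𝓝 w) (𝓝 ((ρ w + 1) * ‖w - w‖)) :=
    (by fun_prop : Continuous fun u => (ρ w + 1) * ‖u - w‖).tendsto w
  rw [sub_self, norm_zero, mul_zero] at this
  refine squeeze_zero' (Eventually.of_forall fun _ => h.nonneg) ?_ this
  filter_upwards [ball_mem_nhds w hr] with u hu
  have hseg : ∀ t ∈ Icc (0:ℝ) 1, w + t • (u - w) ∈ ball w r := fun t ht =>
    (convex_ball w r).add_smul_sub_mem (mem_ball_self hr) hu ht
  have := densityDist_le_mul_norm h.continuousOn h.pos (fun t ht => (hb _ (hseg t ht)).2)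
    (fun t ht => (hb _ (hseg t ht)).1.le)
  simpa using this

end IsAdmissibleDensity

variable {g : ℝ → E}

/-- A `1`-Lipschitz curve of the right duration is a geodesic. -/
lemma IsAdmissibleDensity.isGeodesicIn_of_le (h : IsAdmissibleDensity S ρ)
    (h0 : g 0 = x) (h1 : g (densityDist S ρ x y) = y)
    (hmem : ∀ t ∈ Icc (0:ℝ) (densityDist S ρ x y), g t ∈ S)
    (hle : ∀ s ∈ Icc (0:ℝ) (densityDist S ρ x y), ∀ t ∈ Icc (0:ℝ) (densityDist S ρ x y), s ≤ t →
      densityDist S ρ (g s) (g t) ≤ t - s) :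
    IsGeodesicIn S (densityDist S ρ) g x y := by
  set L := densityDist S ρ x y with hL
  have hL0 : 0 ≤ L := h.nonneg
  have m0 : (0:ℝ) ∈ Icc (0:ℝ) L := left_mem_Icc.2 hL0
  have m1 : L ∈ Icc (0:ℝ) L := right_mem_Icc.2 hL0
  have key : ∀ s ∈ Icc (0:ℝ) L, ∀ t ∈ Icc (0:ℝ) L, s ≤ t →
      densityDist S ρ (g s) (g t) = t - s := by
    intro s hs t ht hst
    refine le_antisymm (hle s hs t ht hst) ?_
    have a1 := hle 0 m0 s hs hs.1
    have a2 := hle t ht L m1 ht.2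
    have a3 := h.triangle (hmem 0 m0) (hmem s hs) (hmem L m1)
    have a4 := h.triangle (hmem s hs) (hmem t ht) (hmem L m1)
    have a5 : densityDist S ρ (g 0) (g L) = L := by rw [h0, h1]
    linarith
  refine ⟨h0, h1, hmem, fun s hs t ht => ?_⟩
  rcases le_total s t with hst | hst
  · rw [key s hs t ht hst, abs_sub_comm, abs_of_nonneg (sub_nonneg.2 hst)]
  · rw [h.comm (hmem s hs) (hmem t ht), key t ht s hs hst, abs_of_nonneg (sub_nonneg.2 hst)]

/-- In a proper length space any two points are joined by a geodesic. -/
theorem IsAdmissibleDensity.exists_isGeodesicIn (h : IsAdmissibleDensity S ρ)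
    (hproper : ∀ x ∈ S, ∀ r : ℝ, ∃ K ⊆ S, IsCompact K ∧ ∀ y ∈ S, densityDist S ρ x y ≤ r → y ∈ K)
    (hx : x ∈ S) (hy : y ∈ S) :
    ∃ g, IsGeodesicIn S (densityDist S ρ) g x y := by
  set L := densityDist S ρ x y with hL
  have hL0 : 0 ≤ L := h.nonneg
  obtain ⟨K, hKS, hK, hKm⟩ := hproper x hx L
  have approx : ∀ n : ℕ, ∃ f : ℝ → E, (∀ s ∈ Icc 0 L, f s ∈ S) ∧
      (∀ s ∈ Icc 0 L, ∀ t ∈ Icc 0 L, s ≤ t → densityDist S ρ (f s) (f t) ≤ t - s) ∧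
      (∀ s ∈ Icc 0 L, densityDist S ρ x (f s) ≤ s) ∧
      densityDist S ρ (f L) y ≤ 1 / ((n : ℝ) + 1) := by
    intro n
    obtain ⟨γ, hγ, hl⟩ := h.exists_path_lt hx hy
      (lt_add_of_pos_right L (Nat.one_div_pos_of_nat (n := n)))
    have hsp := hγ.continuous_speed h.continuousOn
    set Λ : ℝ → ℝ := fun t => ∫ s in (0:ℝ)..t, ρ (γ s) * ‖deriv γ s‖ with hΛ
    have hsub : ∀ s t, Λ t - Λ s = ∫ u in s..t, ρ (γ u) * ‖deriv γ u‖ := fun s t =>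
      intervalIntegral.integral_interval_sub_left (hsp.intervalIntegrable _ _)
        (hsp.intervalIntegrable _ _)
    have hΛc : Continuous Λ := by
      have : ∀ t, HasDerivAt Λ (ρ (γ t) * ‖deriv γ t‖) t := fun t =>
        (hsp.integral_hasStrictDerivAt 0 t).hasDerivAt
      exact continuous_iff_continuousAt.2 fun t => (this t).continuousAt
    have hmono : Monotone Λ := fun s t hst => by
      rw [← sub_nonneg, hsub]
      exact intervalIntegral.integral_nonneg hst fun u _ =>
        mul_nonneg (h.pos _ (hγ.mem u)).le (norm_nonneg _)
    have hd : ∀ s t, s ≤ t → densityDist S ρ (γ s) (γ t) ≤ Λ t - Λ s := fun s t hst => by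
      rw [hsub]; exact densityDist_le_integral h.pos hγ.contDiff hγ.mem hst
    have hΛ0 : Λ 0 = 0 := by simp [hΛ]
    have hΛ1 : Λ 1 = curveLen ρ γ := rfl
    have hL1 : L ≤ Λ 1 := hΛ1 ▸ hγ.densityDist_le h.pos
    have hinv : ∀ s ∈ Icc 0 L, ∃ t ∈ Icc (0:ℝ) 1, Λ t = s := fun s hs =>
      intermediate_value_Icc zero_le_one hΛc.continuousOn
        ⟨by rw [hΛ0]; exact hs.1, hs.2.trans hL1⟩
    choose! τ hτ1 hτ2 using hinv
    have hdd : ∀ s t, Λ s ≤ Λ t → densityDist S ρ (γ s) (γ t) ≤ Λ t - Λ s := by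
      intro s t hst
      rcases le_total s t with h' | h'
      · exact hd s t h'
      · have e := le_antisymm hst (hmono h')
        have := hd t s h'
        rw [h.comm (hγ.mem s) (hγ.mem t)]
        linarith
    refine ⟨fun s => γ (τ s), fun s _ => hγ.mem _, fun s hs t ht hst => ?_, fun s hs => ?_, ?_⟩
    · have := hdd (τ s) (τ t) (by rw [hτ2 s hs, hτ2 t ht]; exact hst)
      rwa [hτ2 s hs, hτ2 t ht] at this
    · have := hd 0 (τ s) (hτ1 s hs).1
      rwa [hΛ0, hτ2 s hs, hγ.source 0 le_rfl, sub_zero] at this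
    · have mL := right_mem_Icc.2 hL0
      have := hd (τ L) 1 (hτ1 L mL).2
      rw [hτ2 L mL, hγ.target 1 le_rfl] at this
      linarith
  choose f hfS hfle hfx hfy using approx
  have hlim : ∀ s ∈ Icc 0 L, ∃ k ∈ S, Tendsto (fun n => f n s) (hyperfilter ℕ) (𝓝 k) := by
    intro s hs
    obtain ⟨k, hk, hle⟩ := hK.ultrafilter_le_nhds ((hyperfilter ℕ).map fun n => f n s) (by
      rw [le_principal_iff]
      exact Filter.mem_map.2 (univ_mem' fun n => hKm _ (hfS n s hs) ((hfx n s hs).trans hs.2)))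
    exact ⟨k, hKS hk, hle⟩
  choose! g hgS hg using hlim
  have hg0 : ∀ s ∈ Icc 0 L, Tendsto (fun n => densityDist S ρ (g s) (f n s)) (hyperfilter ℕ)
      (𝓝 0) := fun s hs => (h.tendsto_zero (hgS s hs)).comp (hg s hs)
  have hgle : ∀ s ∈ Icc 0 L, ∀ t ∈ Icc 0 L, s ≤ t → densityDist S ρ (g s) (g t) ≤ t - s := by
    intro s hs t ht hst
    have hT := ((hg0 s hs).add_const (t - s)).add (hg0 t ht)
    rw [zero_add, add_zero] at hT
    refine ge_of_tendsto hT (Eventually.of_forall fun n => ?_)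
    have a1 := h.triangle (hgS s hs) (hfS n s hs) (hgS t ht)
    have a2 := h.triangle (hfS n s hs) (hfS n t ht) (hgS t ht)
    have a3 := hfle n s hs t ht hst
    rw [h.comm (hfS n t ht) (hgS t ht)] at a2
    linarith
  have m0 : (0:ℝ) ∈ Icc (0:ℝ) L := left_mem_Icc.2 hL0
  have mL : L ∈ Icc (0:ℝ) L := right_mem_Icc.2 hL0
  refine ⟨g, h.isGeodesicIn_of_le ?_ ?_ hgS hgle⟩
  · refine h.eq_of_densityDist_le_zero hx (hgS 0 m0) (ge_of_tendsto (hg0 0 m0)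
      (Eventually.of_forall fun n => ?_))
    have a1 := h.triangle hx (hfS n 0 m0) (hgS 0 m0)
    have a2 := hfx n 0 m0
    rw [h.comm (hfS n 0 m0) (hgS 0 m0)] at a1
    linarith
  · refine (h.eq_of_densityDist_le_zero (hgS L mL) hy ?_).symm
    have hT : Tendsto (fun n : ℕ => densityDist S ρ (g L) (f n L) + 1 / ((n : ℝ) + 1))
        (hyperfilter ℕ) (𝓝 (0 + 0)) :=
      (hg0 L mL).add (tendsto_one_div_add_atTop_nhds_zero_nat.mono_left
        (Nat.cofinite_eq_atTop ▸ hyperfilter_le_cofinite))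
    rw [add_zero] at hT
    refine ge_of_tendsto hT (Eventually.of_forall fun n => ?_)
    have a1 := h.triangle (hgS L mL) (hfS n L mL) hy
    have a2 := hfy n
    linarith

/-- Geodesics are continuous for the norm topology. -/
lemma IsAdmissibleDensity.continuousOn_geodesic (h : IsAdmissibleDensity S ρ)
    (hg : IsGeodesicIn S (densityDist S ρ) g x y) :
    ContinuousOn g (Icc 0 (densityDist S ρ x y)) := by
  intro t ht
  have hp := h.pos _ (hg.2.2.1 t ht)
  obtain ⟨r, hr, hb⟩ := h.exists_mul_min_le (hg.2.2.1 t ht) (half_pos hp).le (half_lt_self hp)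
  rw [Metric.continuousWithinAt_iff]
  intro ε hε
  refine ⟨ρ (g t) / 2 * min r ε, mul_pos (half_pos hp) (lt_min hr hε), fun s hs hst => ?_⟩
  have h1 := hb _ (hg.2.2.1 s hs)
  rw [hg.2.2.2 t ht s hs, ← Real.dist_eq, dist_comm] at h1
  have h2 := lt_of_mul_lt_mul_left (h1.trans_lt hst) (half_pos hp).le
  rw [dist_eq_norm]
  by_contra hcon
  push Not at hcon
  exact absurd h2 (not_lt.2 (min_le_min_left r hcon))

/-- The norm displacement along a geodesic is bounded by the integral of the reciprocal of the
density. -/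
lemma IsAdmissibleDensity.norm_sub_le_of_geodesic (h : IsAdmissibleDensity S ρ)
    (hg : IsGeodesicIn S (densityDist S ρ) g x y) {a b : ℝ} (hab : a ≤ b) (ha : 0 ≤ a)
    (hb : b ≤ densityDist S ρ x y) {B B' : ℝ → ℝ} (hB : ∀ t, HasDerivAt B (B' t) t)
    (hle : ∀ t ∈ Icc a b, (ρ (g t))⁻¹ ≤ B' t) : ‖g b - g a‖ ≤ B b - B a := by
  have hsub : Icc a b ⊆ Icc 0 (densityDist S ρ x y) := Icc_subset_Icc ha hb
  refine image_le_of_liminf_slope_right_le_deriv_boundary (f := fun t => ‖g t - g a‖) (a := a)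
    (b := b) (((h.continuousOn_geodesic hg).mono hsub).sub continuousOn_const).norm
    (B := fun t => B t - B a) (B' := B') (by simp)
    (fun t _ => ((hB t).sub_const _).continuousAt.continuousWithinAt)
    (fun t _ => ((hB t).sub_const _).hasDerivWithinAt) ?_ (right_mem_Icc.2 hab)
  intro t ht r hr
  have htI := hsub (Ico_subset_Icc_self ht)
  have hp := h.pos _ (hg.2.2.1 t htI)
  have hlt : (ρ (g t))⁻¹ < r := (hle t (Ico_subset_Icc_self ht)).trans_lt hr
  have hr0 : 0 < r := (inv_pos.2 hp).trans hlt
  obtain ⟨κ, hκ1, hκ2⟩ := exists_between (inv_lt_of_inv_lt₀ hp hlt)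
  have hκ0 : 0 < κ := (inv_pos.2 hr0).trans hκ1
  obtain ⟨q, hq, hbd⟩ := h.exists_mul_min_le (hg.2.2.1 t htI) hκ0.le hκ2
  refine Eventually.frequently ?_
  have hc : ContinuousWithinAt g (Ioi t) t := by
    refine ((h.continuousOn_geodesic hg t htI).mono_of_mem_nhdsWithin ?_)
    exact mem_of_superset (Icc_mem_nhdsGT ht.2) (fun s hs => hsub ⟨ht.1.trans hs.1, hs.2⟩)
  have h2 : ∀ᶠ s in 𝓝[>] t, ‖g s - g t‖ < q := by
    have := (hc.sub (continuousWithinAt_const (b := g t))).norm.eventually_lt_const (u := q)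
      (by simpa using hq)
    exact this
  filter_upwards [h2, Ioc_mem_nhdsGT ht.2] with s hs1 hs2
  have hst : 0 < s - t := sub_pos.2 hs2.1
  have hsI := hsub ⟨ht.1.trans hs2.1.le, hs2.2⟩
  have h3 := hbd _ (hg.2.2.1 s hsI)
  rw [min_eq_right hs1.le, hg.2.2.2 t htI s hsI, abs_sub_comm, abs_of_pos hst] at h3
  rw [slope_def_field, div_lt_iff₀ hst]
  have h4 : ‖g s - g a‖ - ‖g t - g a‖ ≤ ‖g s - g t‖ := by
    have := norm_sub_norm_le (g s - g a) (g t - g a)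
    rwa [sub_sub_sub_cancel_right] at this
  refine h4.trans_lt ?_
  have h5 : ‖g s - g t‖ ≤ κ⁻¹ * (s - t) := by
    rw [le_inv_mul_iff₀ hκ0]; exact h3
  exact h5.trans_lt (mul_lt_mul_of_pos_right (inv_lt_of_inv_lt₀ hr0 hκ1) hst)

end LengthSpace

lemma Real.abs_log_sub_log_le {a b : ℝ} (ha : 0 < a) (hb : 0 < b) :
    |Real.log a - Real.log b| ≤ |a - b| / min a b := by
  have key : ∀ {a b : ℝ}, 0 < a → 0 < b → Real.log a - Real.log b ≤ |a - b| / min a b := by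
    intro a b ha hb
    rw [← Real.log_div ha.ne' hb.ne']
    have hm : 0 < min a b := lt_min ha hb
    calc Real.log (a / b) ≤ a / b - 1 := Real.log_le_sub_one_of_pos (div_pos ha hb)
      _ = (a - b) / b := by field_simp
      _ ≤ |a - b| / b := by gcongr; exact le_abs_self _
      _ ≤ |a - b| / min a b := by gcongr; exact min_le_right _ _
  rw [abs_le]
  constructor
  · have := key hb ha
    rw [abs_sub_comm, min_comm] at this
    linarith
  · exact key ha hb

/-- A density on a plane domain which, up to constants, obeys the upper bound of the
quasihyperbolic density and the lower bound given by the twice punctured planes containing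
the domain. -/
structure IsLandauDensity (Ω : Set ℂ) (ρ : ℂ → ℝ) (c : ℝ) : Prop where
  admissible : IsAdmissibleDensity Ω ρ
  const_pos : 0 < c
  mul_infDist_le : ∀ z ∈ Ω, ρ z * infDist z Ωᶜ ≤ 2
  le_mul : ∀ z ∈ Ω, ∀ e ∈ Ωᶜ, ∀ e' ∈ Ωᶜ, e ≠ e' →
    c ≤ ρ z * (‖z - e‖ * (1 + |Real.log (‖z - e‖ / ‖e' - e‖)|))

namespace IsLandauDensity

variable {Ω : Set ℂ} {ρ : ℂ → ℝ} {c : ℝ} {x y e e' e₁ e₂ z : ℂ}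

lemma norm_sub_pos (hz : z ∈ Ω) (he : e ∈ Ωᶜ) : 0 < ‖z - e‖ :=
  norm_pos_iff.2 (sub_ne_zero.2 fun h => he (h ▸ hz))

lemma abs_log_sub_le (h : IsLandauDensity Ω ρ c) (he : e ∈ Ωᶜ) (he' : e' ∈ Ωᶜ) (hne : e ≠ e')
    (hx : x ∈ Ω) (hy : y ∈ Ω) :
    c * |Real.log (1 + |Real.log (‖x - e‖ / ‖e' - e‖)|) -
      Real.log (1 + |Real.log (‖y - e‖ / ‖e' - e‖)|)| ≤ densityDist Ω ρ x y := by
  set A : ℂ → ℝ := fun w => |Real.log (‖w - e‖ / ‖e' - e‖)| with hA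
  have hD : 0 < ‖e' - e‖ := norm_pos_iff.2 (sub_ne_zero.2 hne.symm)
  have hA0 : ∀ w, 0 ≤ A w := fun w => abs_nonneg _
  have := h.admissible.abs_sub_le (F := fun w => c * Real.log (1 + A w)) ?_ hx hy
  · rwa [← mul_sub, abs_mul, abs_of_pos h.const_pos] at this
  · intro w hw κ hκ
    have hwe := norm_sub_pos hw he
    have hcont : ContinuousAt (fun u => c / (min ‖u - e‖ ‖w - e‖ * (1 + min (A u) (A w)))) w := by
      have hAc : ContinuousAt A w := by
        refine ContinuousAt.abs (ContinuousAt.log ?_ ?_)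
        · fun_prop
        · positivity
      have h1 : ContinuousAt (fun u => ‖u - e‖) w := by fun_prop
      refine continuousAt_const.div ((h1.min continuousAt_const).mul
        (continuousAt_const.add (hAc.min continuousAt_const))) ?_
      have := hA0 w
      simp only [min_self]
      positivity
    have hlt : c / (min ‖w - e‖ ‖w - e‖ * (1 + min (A w) (A w))) < κ := by
      have := hA0 w
      rw [min_self, min_self, div_lt_iff₀ (by positivity)]
      refine (h.le_mul w hw e he e' he' hne).trans_lt ?_
      exact mul_lt_mul_of_pos_right hκ (by positivity)
    filter_upwards [hcont.eventually_lt_const hlt, h.admissible.isOpen.mem_nhds hw] with u hu huΩ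
    have hue := norm_sub_pos huΩ he
    refine le_trans ?_ (mul_le_mul_of_nonneg_right hu.le (norm_nonneg _))
    rw [← mul_sub, abs_mul, abs_of_pos h.const_pos]
    have a1 := hA0 u
    have a2 := hA0 w
    have s1 := Real.abs_log_sub_log_le (a := 1 + A u) (b := 1 + A w) (by positivity) (by positivity)
    rw [add_sub_add_left_eq_sub, min_add_add_left] at s1
    have s2 : |A u - A w| ≤ ‖u - w‖ / min ‖u - e‖ ‖w - e‖ := by
      refine (abs_abs_sub_abs_le_abs_sub _ _).trans ?_
      rw [Real.log_div hue.ne' hD.ne', Real.log_div hwe.ne' hD.ne', sub_sub_sub_cancel_right]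
      refine (Real.abs_log_sub_log_le hue hwe).trans ?_
      gcongr
      simpa using abs_norm_sub_norm_le (u - e) (w - e)
    have hm : 0 < min ‖u - e‖ ‖w - e‖ := lt_min hue hwe
    have hm' : 0 ≤ min (A u) (A w) := le_min a1 a2
    calc c * |Real.log (1 + A u) - Real.log (1 + A w)|
        ≤ c * (‖u - w‖ / min ‖u - e‖ ‖w - e‖ / (1 + min (A u) (A w))) := by
          have := h.const_pos
          gcongr
          exact s1.trans (by gcongr)
      _ = _ := by rw [div_div, mul_div_assoc', div_mul_eq_mul_div]

lemma exp_neg_mul_le (h : IsLandauDensity Ω ρ c) (he : e ∈ Ωᶜ) (he' : e' ∈ Ωᶜ) (hne : e ≠ e')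
    (hx : x ∈ Ω) (hy : y ∈ Ω) {r A₀ : ℝ} (hr : densityDist Ω ρ x y ≤ r)
    (hA₀ : |Real.log (‖x - e‖ / ‖e' - e‖)| ≤ A₀) :
    ‖e' - e‖ * Real.exp (-((1 + A₀) * Real.exp (r / c))) ≤ ‖y - e‖ ∧
      ‖y - e‖ ≤ ‖e' - e‖ * Real.exp ((1 + A₀) * Real.exp (r / c)) := by
  have hD : 0 < ‖e' - e‖ := norm_pos_iff.2 (sub_ne_zero.2 hne.symm)
  have hye := norm_sub_pos hy he
  have h1 := (h.abs_log_sub_le he he' hne hx hy).trans hr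
  have hc := h.const_pos
  have h2 : |Real.log (1 + |Real.log (‖x - e‖ / ‖e' - e‖)|) -
      Real.log (1 + |Real.log (‖y - e‖ / ‖e' - e‖)|)| ≤ r / c := by
    rwa [le_div_iff₀ hc, mul_comm]
  have h3 := (abs_le.1 h2).1
  have pA := abs_nonneg (Real.log (‖x - e‖ / ‖e' - e‖))
  have pB := abs_nonneg (Real.log (‖y - e‖ / ‖e' - e‖))
  have h4 : |Real.log (‖y - e‖ / ‖e' - e‖)| ≤ (1 + A₀) * Real.exp (r / c) := by
    have h5 : Real.log (1 + |Real.log (‖y - e‖ / ‖e' - e‖)|) ≤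
        Real.log (1 + |Real.log (‖x - e‖ / ‖e' - e‖)|) + r / c := by linarith
    rw [Real.log_le_iff_le_exp (by positivity), Real.exp_add, Real.exp_log (by positivity)] at h5
    have h6 : (1 + |Real.log (‖x - e‖ / ‖e' - e‖)|) * Real.exp (r / c) ≤
      (1 + A₀) * Real.exp (r / c) := by gcongr
    linarith
  obtain ⟨h5, h6⟩ := abs_le.1 h4
  rw [Real.le_log_iff_exp_le (by positivity), le_div_iff₀ hD, mul_comm] at h5
  rw [Real.log_le_iff_le_exp (by positivity), div_le_iff₀ hD, mul_comm] at h6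
  exact ⟨h5, h6⟩

/-- Closed balls of the distance induced by a Landau density are relatively compact. -/
lemma exists_isCompact (h : IsLandauDensity Ω ρ c) (h₁ : e₁ ∈ Ωᶜ) (h₂ : e₂ ∈ Ωᶜ) (hne : e₁ ≠ e₂)
    (hx : x ∈ Ω) (r : ℝ) :
    ∃ K ⊆ Ω, IsCompact K ∧ ∀ y ∈ Ω, densityDist Ω ρ x y ≤ r → y ∈ K := by
  have hcl : IsClosed Ωᶜ := h.admissible.isOpen.isClosed_compl
  have hnon : (Ωᶜ).Nonempty := ⟨_, h₁⟩
  set R := ‖e₂ - e₁‖ * Real.exp ((1 + |Real.log (‖x - e₁‖ / ‖e₂ - e₁‖)|) * Real.exp (r / c))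
  have hR : ∀ y ∈ Ω, densityDist Ω ρ x y ≤ r → ‖y - e₁‖ ≤ R := fun y hy hr =>
    (h.exp_neg_mul_le h₁ h₂ hne hx hy hr le_rfl).2
  set q := ‖e₂ - e₁‖ / 2
  have hq : 0 < q := half_pos (norm_pos_iff.2 (sub_ne_zero.2 hne.symm))
  set Q := 2 * R + ‖e₂ - e₁‖
  set δ := infDist x Ωᶜ
  have hδ : 0 < δ := (hcl.notMem_iff_infDist_pos hnon).1 (not_not.2 hx)
  set P := ‖x - e₁‖ + 2 * R
  set A₀ := (|Real.log δ| + |Real.log P|) + (|Real.log q| + |Real.log Q|)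
  set η := q * Real.exp (-((1 + A₀) * Real.exp (r / c)))
  have hη : 0 < η := by positivity
  have hlog : ∀ {l u v : ℝ}, 0 < l → l ≤ v → v ≤ u →
      |Real.log v| ≤ |Real.log l| + |Real.log u| := by
    intro l u v hl h1 h2
    have a1 := Real.log_le_log hl h1
    have a2 := Real.log_le_log (hl.trans_le h1) h2
    rw [abs_le]
    constructor <;> linarith [neg_abs_le (Real.log l), le_abs_self (Real.log u),
      abs_nonneg (Real.log l), abs_nonneg (Real.log u)]
  refine ⟨closedBall e₁ R ∩ {y | η ≤ infDist y Ωᶜ}, ?_, ?_, ?_⟩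
  · rintro y ⟨-, hy⟩
    by_contra hcon
    have : infDist y Ωᶜ = 0 := infDist_zero_of_mem hcon
    simp only [mem_ofPred_eq] at hy
    linarith
  · exact (isCompact_closedBall _ _).inter_right
      (isClosed_le continuous_const (continuous_infDist_pt _))
  · intro y hy hr
    have hyR := hR y hy hr
    refine ⟨mem_closedBall_iff_norm.2 hyR, ?_⟩
    obtain ⟨e, he, hye⟩ := hcl.exists_infDist_eq_dist hnon y
    have hee : ‖e - e₁‖ ≤ 2 * R := by
      have h1 := infDist_le_dist_of_mem (x := y) h₁
      rw [hye, dist_eq_norm, dist_eq_norm, ← norm_neg, neg_sub] at h1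
      calc ‖e - e₁‖ = ‖(e - y) + (y - e₁)‖ := by simp
        _ ≤ _ := norm_add_le _ _
        _ ≤ _ := by linarith
    obtain ⟨e', he', hq', hQ'⟩ : ∃ e' ∈ Ωᶜ, q ≤ ‖e' - e‖ ∧ ‖e' - e‖ ≤ Q := by
      have t1 : ‖e₂ - e₁‖ ≤ ‖e₂ - e‖ + ‖e₁ - e‖ := by
        have := norm_sub_le (e₂ - e) (e₁ - e)
        simpa using this
      have t2 : ‖e₂ - e‖ ≤ ‖e₂ - e₁‖ + ‖e - e₁‖ := by
        have := norm_sub_le (e₂ - e₁) (e - e₁)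
        simpa using this
      rcases le_total q ‖e₂ - e‖ with hc | hc
      · exact ⟨e₂, h₂, hc, by simp only [Q]; linarith⟩
      · refine ⟨e₁, h₁, ?_, ?_⟩
        · simp only [q] at hc ⊢; linarith
        · rw [norm_sub_rev]; simp only [Q]; linarith [norm_nonneg (e₂ - e₁)]
    have hne' : e ≠ e' := by rintro rfl; simp at hq'; linarith
    have hA : |Real.log (‖x - e‖ / ‖e' - e‖)| ≤ A₀ := by
      rw [Real.log_div (norm_sub_pos hx he).ne' (hq.trans_le hq').ne']
      refine (abs_sub _ _).trans (add_le_add ?_ (hlog hq hq' hQ'))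
      refine hlog hδ ?_ ?_
      · rw [← dist_eq_norm]; exact infDist_le_dist_of_mem he
      · have := norm_sub_le (x - e₁) (e - e₁)
        rw [sub_sub_sub_cancel_right] at this
        simp only [P]; linarith
    have := (h.exp_neg_mul_le he he' hne' hx hy hr hA).1
    rw [mem_ofPred_eq, hye, dist_eq_norm]
    refine le_trans ?_ this
    simp only [η]
    gcongr

lemma exists_isGeodesicIn (h : IsLandauDensity Ω ρ c) (h₁ : e₁ ∈ Ωᶜ) (h₂ : e₂ ∈ Ωᶜ) (hne : e₁ ≠ e₂)
    (hx : x ∈ Ω) (hy : y ∈ Ω) : ∃ g, IsGeodesicIn Ω (densityDist Ω ρ) g x y :=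
  h.admissible.exists_isGeodesicIn (fun _ hx r => h.exists_isCompact h₁ h₂ hne hx r) hx hy

end IsLandauDensity

open ComplexConjugate in
/-- A density invariant under reflection in the real axis. -/
structure IsConjInvariant (Ω : Set ℂ) (ρ : ℂ → ℝ) : Prop where
  conj_mem : ∀ z ∈ Ω, conj z ∈ Ω
  density_conj : ∀ z ∈ Ω, ρ (conj z) = ρ z

/-- Reflection of the lower half plane onto the upper half plane. -/
def foldUp (z : ℂ) : ℂ := ⟨z.re, |z.im|⟩

section Fold

open ComplexConjugate

variable {Ω : Set ℂ} {ρ : ℂ → ℝ} {x y z w : ℂ} {g : ℝ → ℂ}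

lemma foldUp_of_nonneg (h : 0 ≤ z.im) : foldUp z = z := by
  apply Complex.ext <;> simp [foldUp, abs_of_nonneg h]

lemma foldUp_of_nonpos (h : z.im ≤ 0) : foldUp z = conj z := by
  apply Complex.ext <;> simp [foldUp, abs_of_nonpos h]

lemma conj_of_im_eq_zero (h : z.im = 0) : conj z = z := by
  apply Complex.ext <;> simp [h]

lemma IsConjInvariant.foldUp_mem (hs : IsConjInvariant Ω ρ) (hz : z ∈ Ω) : foldUp z ∈ Ω := by
  rcases le_total 0 z.im with h | h
  · rwa [foldUp_of_nonneg h]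
  · rw [foldUp_of_nonpos h]; exact hs.conj_mem z hz

lemma IsConjInvariant.densityDist_conj (h : IsAdmissibleDensity Ω ρ) (hs : IsConjInvariant Ω ρ)
    (hz : z ∈ Ω) (hw : w ∈ Ω) :
    densityDist Ω ρ (conj z) (conj w) = densityDist Ω ρ z w := by
  have key : ∀ z ∈ Ω, ∀ w ∈ Ω, densityDist Ω ρ (conj z) (conj w) ≤ densityDist Ω ρ z w := by
    intro z hz w hw
    refine le_of_forall_pos_le_add fun ε hε => ?_
    obtain ⟨γ, hγ, hl⟩ := h.exists_path_lt hz hw (lt_add_of_pos_right _ hε)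
    refine le_trans ?_ hl.le
    have hγ' : IsSmoothPath Ω (fun t => conj (γ t)) (conj z) (conj w) :=
      ⟨conjCLE.contDiff.comp hγ.contDiff, fun t => hs.conj_mem _ (hγ.mem t),
        fun t ht => by rw [hγ.source t ht], fun t ht => by rw [hγ.target t ht]⟩
    refine (hγ'.densityDist_le h.pos).trans_eq ?_
    unfold curveLen
    congr 1
    ext t
    have hd : HasDerivAt (fun t => conj (γ t)) (conj (deriv γ t)) t :=
      (hγ.contDiff.differentiable one_ne_zero t).hasDerivAt.star
    rw [hd.deriv, hs.density_conj _ (hγ.mem t), norm_conj]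
  refine le_antisymm (key z hz w hw) ?_
  simpa using key _ (hs.conj_mem z hz) _ (hs.conj_mem w hw)

/-- A path between the two closed half planes meets the real axis. -/
lemma IsAdmissibleDensity.exists_real_add_lt (h : IsAdmissibleDensity Ω ρ) (hz : z ∈ Ω)
    (hw : w ∈ Ω) (hzi : 0 ≤ z.im) (hwi : w.im ≤ 0) {r : ℝ} (hr : densityDist Ω ρ z w < r) :
    ∃ u ∈ Ω, u.im = 0 ∧ densityDist Ω ρ z u + densityDist Ω ρ u w < r := by
  obtain ⟨γ, hγ, hl⟩ := h.exists_path_lt hz hw hr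
  have hc : ContinuousOn (fun t => (γ t).im) (Icc 0 1) :=
    (Complex.continuous_im.comp hγ.contDiff.continuous).continuousOn
  have h0 := hγ.source 0 le_rfl
  have h1 := hγ.target 1 le_rfl
  obtain ⟨t, htI, ht⟩ : (0:ℝ) ∈ (fun t => (γ t).im) '' Icc 0 1 :=
    intermediate_value_Icc' zero_le_one hc ⟨by simpa [h1] using hwi, by simpa [h0] using hzi⟩
  refine ⟨γ t, hγ.mem t, ht, lt_of_le_of_lt ?_ hl⟩
  have i1 := densityDist_le_integral h.pos hγ.contDiff hγ.mem htI.1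
  have i2 := densityDist_le_integral h.pos hγ.contDiff hγ.mem htI.2
  rw [h0] at i1
  rw [h1] at i2
  unfold curveLen
  have hi := fun a b => (hγ.continuous_speed h.continuousOn).intervalIntegrable
    (μ := MeasureTheory.volume) a b
  rw [← intervalIntegral.integral_add_adjacent_intervals (hi 0 t) (hi t 1)]
  exact add_le_add i1 i2

lemma IsConjInvariant.densityDist_foldUp_le (h : IsAdmissibleDensity Ω ρ)
    (hs : IsConjInvariant Ω ρ) (hz : z ∈ Ω) (hw : w ∈ Ω) :
    densityDist Ω ρ (foldUp z) (foldUp w) ≤ densityDist Ω ρ z w := by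
  have key : ∀ z ∈ Ω, ∀ w ∈ Ω, 0 ≤ z.im → w.im ≤ 0 →
      densityDist Ω ρ z (conj w) ≤ densityDist Ω ρ z w := by
    intro z hz w hw hzi hwi
    refine le_of_forall_pos_le_add fun ε hε => ?_
    obtain ⟨u, hu, hui, hlt⟩ := h.exists_real_add_lt hz hw hzi hwi (lt_add_of_pos_right _ hε)
    refine (h.triangle hz hu (hs.conj_mem w hw)).trans ?_
    have := hs.densityDist_conj h hu hw
    rw [conj_of_im_eq_zero hui] at this
    rw [this]
    exact hlt.le
  rcases le_total 0 z.im with h1 | h1 <;> rcases le_total 0 w.im with h2 | h2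
  · rw [foldUp_of_nonneg h1, foldUp_of_nonneg h2]
  · rw [foldUp_of_nonneg h1, foldUp_of_nonpos h2]
    exact key z hz w hw h1 h2
  · rw [foldUp_of_nonpos h1, foldUp_of_nonneg h2, h.comm (hs.conj_mem z hz) hw, h.comm hz hw]
    exact key w hw z hz h2 h1
  · rw [foldUp_of_nonpos h1, foldUp_of_nonpos h2, hs.densityDist_conj h hz hw]

lemma IsConjInvariant.isGeodesicIn_foldUp (h : IsAdmissibleDensity Ω ρ)
    (hs : IsConjInvariant Ω ρ) (hx : x.im = 0) (hy : y.im = 0)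
    (hg : IsGeodesicIn Ω (densityDist Ω ρ) g x y) :
    IsGeodesicIn Ω (densityDist Ω ρ) (fun t => foldUp (g t)) x y := by
  obtain ⟨g0, g1, gm, gd⟩ := hg
  refine h.isGeodesicIn_of_le ?_ ?_ (fun t ht => hs.foldUp_mem (gm t ht)) ?_
  · simp only [g0, foldUp_of_nonneg hx.ge]
  · simp only [g1, foldUp_of_nonneg hy.ge]
  · intro s hs' t ht hst
    refine (hs.densityDist_foldUp_le h (gm s hs') (gm t ht)).trans_eq ?_
    rw [gd s hs' t ht, abs_sub_comm, abs_of_nonneg (sub_nonneg.2 hst)]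

lemma IsConjInvariant.isGeodesicIn_conj (h : IsAdmissibleDensity Ω ρ)
    (hs : IsConjInvariant Ω ρ) (hx : x.im = 0) (hy : y.im = 0)
    (hg : IsGeodesicIn Ω (densityDist Ω ρ) g x y) :
    IsGeodesicIn Ω (densityDist Ω ρ) (fun t => conj (g t)) x y := by
  obtain ⟨g0, g1, gm, gd⟩ := hg
  refine ⟨?_, ?_, fun t ht => hs.conj_mem _ (gm t ht), fun s hs' t ht => ?_⟩
  · simp only [g0, conj_of_im_eq_zero hx]
  · simp only [g1, conj_of_im_eq_zero hy]
  · rw [hs.densityDist_conj h (gm s hs') (gm t ht), gd s hs' t ht]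

/-- In a reflection invariant Gromov hyperbolic domain, a geodesic of the closed upper half plane
joining two real points stays close to the real axis. -/
lemma IsConjInvariant.exists_real_near (h : IsAdmissibleDensity Ω ρ) (hs : IsConjInvariant Ω ρ)
    {δ : ℝ} (hyp : GromovHyperbolicWith Ω (densityDist Ω ρ) δ) (hx : x.im = 0) (hy : y.im = 0)
    (hg : IsGeodesicIn Ω (densityDist Ω ρ) g x y)
    (hup : ∀ t ∈ Icc 0 (densityDist Ω ρ x y), 0 ≤ (g t).im)
    {t : ℝ} (ht : t ∈ Icc 0 (densityDist Ω ρ x y)) :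
    ∃ u ∈ Ω, u.im = 0 ∧ densityDist Ω ρ (g t) u ≤ δ + 1 := by
  have hL : 0 ≤ densityDist Ω ρ x y := h.nonneg
  have hxΩ : x ∈ Ω := hg.1 ▸ hg.2.2.1 0 ⟨le_rfl, hL⟩
  have hyΩ : y ∈ Ω := hg.2.1 ▸ hg.2.2.1 _ ⟨hL, le_rfl⟩
  have hconst : IsGeodesicIn Ω (densityDist Ω ρ) (fun _ => y) y y := by
    refine ⟨rfl, rfl, fun _ _ => hyΩ, ?_⟩
    rw [densityDist_self h.pos hyΩ]
    intro s hs t ht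
    rw [Icc_self, mem_singleton_iff] at hs ht
    simp [hs, ht, densityDist_self h.pos hyΩ]
  obtain ⟨p, hp, hpd⟩ := hyp x hxΩ y hyΩ y hyΩ g _ _ hg (hs.isGeodesicIn_conj h hx hy hg)
    hconst t ht
  obtain ⟨hpΩ, hpi⟩ : p ∈ Ω ∧ p.im ≤ 0 := by
    rcases hp with ⟨s, hsI, rfl⟩ | ⟨s, -, rfl⟩
    · exact ⟨hs.conj_mem _ (hg.2.2.1 s hsI), by simpa using hup s hsI⟩
    · exact ⟨hyΩ, hy.le⟩
  obtain ⟨u, hu, hui, hlt⟩ := h.exists_real_add_lt (hg.2.2.1 t ht) hpΩ (hup t ht) hpi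
    (hpd.trans_lt (lt_add_one δ))
  exact ⟨u, hu, hui, by linarith [h.nonneg (x := u) (y := p)]⟩

end Fold

/-- Every point of `[R/2, 3R/2]` is within `σ` of the real number set `{t | (t : ℂ) ∉ Ω}`. -/
def HasDenseComplementAt (Ω : Set ℂ) (R σ : ℝ) : Prop :=
  ∀ u ∈ Icc (R / 2) (3 * R / 2), ∃ t : ℝ, (t : ℂ) ∈ Ωᶜ ∧ |t - u| ≤ σ

namespace IsLandauDensity

variable {Ω : Set ℂ} {ρ : ℂ → ℝ} {c R σ H : ℝ} {x y p q u w e e' z : ℂ} {g : ℝ → ℂ}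

lemma norm_sub_ofReal_le (w : ℂ) (t : ℝ) : ‖w - t‖ ≤ |w.im| + |t - w.re| := by
  have := norm_le_abs_re_add_abs_im (w - t)
  simp only [sub_re, ofReal_re, sub_im, ofReal_im, sub_zero] at this
  rw [abs_sub_comm w.re] at this
  linarith

lemma le_mul_dist (h : IsLandauDensity Ω ρ c) (hz : z ∈ Ω) (he : e ∈ Ωᶜ) (he' : e' ∈ Ωᶜ)
    (hle : ‖z - e‖ ≤ ‖e' - e‖) : c ≤ ρ z * ‖e' - e‖ := by
  have h1 := norm_sub_pos hz he
  have h2 := h1.trans_le hle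
  have hne : e ≠ e' := by rintro rfl; simp at h2
  refine (h.le_mul z hz e he e' he' hne).trans ?_
  have := (h.admissible.pos z hz).le
  gcongr
  rw [Real.log_div h1.ne' h2.ne', abs_sub_comm,
    abs_of_nonneg (sub_nonneg.2 (Real.log_le_log h1 hle)), ← Real.log_div h2.ne' h1.ne']
  have h3 := Real.log_le_sub_one_of_pos (div_pos h2 h1)
  calc ‖z - e‖ * (1 + Real.log (‖e' - e‖ / ‖z - e‖)) ≤ ‖z - e‖ * (‖e' - e‖ / ‖z - e‖) := by
        gcongr; linarith
    _ = _ := by field_simp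

lemma sq_le_mul_dist (h : IsLandauDensity Ω ρ c) (hz : z ∈ Ω) (he : e ∈ Ωᶜ) (he' : e' ∈ Ωᶜ)
    (hle : ‖z - e‖ ≤ ‖e' - e‖) : c ^ 2 ≤ ρ z ^ 2 * (4 * (‖z - e‖ * ‖e' - e‖)) := by
  have h1 := norm_sub_pos hz he
  have h2 := h1.trans_le hle
  have hne : e ≠ e' := by rintro rfl; simp at h2
  have key := h.le_mul z hz e he e' he' hne
  have hρ := (h.admissible.pos z hz).le
  rw [Real.log_div h1.ne' h2.ne', abs_sub_comm,
    abs_of_nonneg (sub_nonneg.2 (Real.log_le_log h1 hle)), ← Real.log_div h2.ne' h1.ne'] at key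
  set s := Real.sqrt (‖e' - e‖ / ‖z - e‖)
  have hs : 0 < s := Real.sqrt_pos.2 (div_pos h2 h1)
  have hs2 : s ^ 2 = ‖e' - e‖ / ‖z - e‖ := Real.sq_sqrt (div_pos h2 h1).le
  rw [← hs2, Real.log_pow] at key
  have h3 := Real.log_le_sub_one_of_pos hs
  have h4 : c ≤ ρ z * (‖z - e‖ * (2 * s)) := by
    refine key.trans ?_
    gcongr
    push_cast
    linarith
  calc c ^ 2 ≤ (ρ z * (‖z - e‖ * (2 * s))) ^ 2 := by
        have := h.const_pos.le
        gcongr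
    _ = ρ z ^ 2 * (4 * ‖z - e‖ ^ 2 * s ^ 2) := by ring
    _ = _ := by rw [hs2]; field_simp

lemma le_mul_of_norm_sub_le (h : IsLandauDensity Ω ρ c) (hd : HasDenseComplementAt Ω R σ)
    (hσ : 0 < σ) (hw : |w.re - R| ≤ R / 4) (hs : |w.im| + σ ≤ R / 20) (hu : u ∈ Ω)
    (huw : ‖u - w‖ ≤ (|w.im| + σ) / 2) : c ≤ ρ u * (4 * (|w.im| + σ)) := by
  set s := |w.im| + σ
  have hs0 : σ ≤ s := by simp only [s]; linarith [abs_nonneg w.im]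
  have r1 := abs_re_le_norm (u - w)
  have r2 := abs_im_le_norm (u - w)
  rw [sub_re] at r1
  rw [sub_im] at r2
  have r3 : |u.im| ≤ |w.im| + |u.im - w.im| := by
    have := abs_add_le w.im (u.im - w.im); rwa [add_sub_cancel] at this
  rw [abs_le] at hw
  have r1' := abs_le.1 r1
  obtain ⟨t, ht, htu⟩ := hd u.re ⟨by linarith, by linarith⟩
  have htu' := abs_le.1 htu
  obtain ⟨t', ht', htt⟩ := hd (t + 3 * s) ⟨by linarith, by linarith⟩
  have htt' := abs_le.1 htt
  have hpos : 0 < t' - t := by linarith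
  have hn : ‖(t' : ℂ) - t‖ = t' - t := by
    rw [← ofReal_sub, norm_real, Real.norm_of_nonneg hpos.le]
  have h1 : ‖u - t‖ ≤ ‖(t' : ℂ) - t‖ := by
    rw [hn]
    refine (norm_sub_ofReal_le u t).trans ?_
    simp only [s] at *
    linarith
  refine (h.le_mul_dist hu ht ht' h1).trans ?_
  rw [hn]
  have := (h.admissible.pos u hu).le
  gcongr
  linarith

lemma norm_sub_lt_of_densityDist_le (h : IsLandauDensity Ω ρ c) (hd : HasDenseComplementAt Ω R σ)
    (hσ : 0 < σ) (hwΩ : w ∈ Ω) (hw : |w.re - R| ≤ R / 4) (hs : |w.im| + σ ≤ R / 20) (hx : x ∈ Ω)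
    (hdist : densityDist Ω ρ w x ≤ c / 9) : ‖x - w‖ < (|w.im| + σ) / 2 := by
  set s := |w.im| + σ
  have hs0 : 0 < s := by positivity
  have hc := h.const_pos
  have := h.admissible.mul_min_le (κ := c / (4 * s)) (r := s / 2) (by positivity)
    (fun u hu huw => by
      rw [div_le_iff₀ (by positivity)]
      exact h.le_mul_of_norm_sub_le hd hσ hw hs hu huw) hwΩ hx (by positivity)
  by_contra! hcon
  rw [min_eq_left hcon] at this
  have e1 : c / (4 * s) * (s / 2) = c / 8 := by field_simp; norm_num
  linarith

/-- A point at height `H`, with `H` small compared to `R` but large compared to the gaps, is far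
from the real axis. -/
lemma lt_densityDist_of_im_eq_zero (h : IsLandauDensity Ω ρ c) (hd : HasDenseComplementAt Ω R σ)
    (hσ : 0 < σ) (hgeo : ∀ x ∈ Ω, ∀ y ∈ Ω, ∃ g, IsGeodesicIn Ω (densityDist Ω ρ) g x y)
    {N : ℕ} (hH : 0 < H) (hHR : (H + σ) * 2 ^ N ≤ R / 20) (hσH : σ * 2 ^ N < H) (hz : z ∈ Ω)
    (hzre : |z.re - R| ≤ R / 8) (hzim : z.im = H) (hu : u ∈ Ω) (hui : u.im = 0) :
    N * (c / 9) < densityDist Ω ρ z u := by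
  by_contra! hcon
  have hc := h.const_pos
  obtain ⟨g, g0, g1, gm, gd⟩ := hgeo z hz u hu
  set L := densityDist Ω ρ z u
  have hL : 0 ≤ L := h.admissible.nonneg
  set T : ℕ → ℝ := fun k => min (k * (c / 9)) L
  have hT : ∀ k, T k ∈ Icc 0 L := fun k => ⟨le_min (by positivity) hL, min_le_right _ _⟩
  have hT1 : ∀ k, |T k - T (k + 1)| ≤ c / 9 := by
    intro k
    have := abs_min_sub_min_le_max (k * (c / 9)) L ((k + 1 : ℕ) * (c / 9)) L
    refine this.trans ?_
    push_cast
    rw [show (k : ℝ) * (c / 9) - (k + 1) * (c / 9) = -(c / 9) by ring, abs_neg, sub_self, abs_zero,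
      abs_of_pos (by positivity)]
    exact max_le le_rfl (by positivity)
  have key : ∀ k ≤ N, H + σ ≤ (|(g (T k)).im| + σ) * 2 ^ k ∧
      |(g (T k)).im| + σ ≤ (H + σ) * 2 ^ k ∧
      |(g (T k)).re - R| ≤ R / 8 + (H + σ) * (2 ^ k - 1) := by
    intro k
    induction k with
    | zero =>
      intro _
      have : T 0 = 0 := by simp [T, hL]
      simp [this, g0, hzim, hzre, abs_of_pos hH]
    | succ k ih =>
      intro hk
      obtain ⟨i1, i2, i3⟩ := ih (by omega)
      have hpow : (2:ℝ) ^ k ≤ 2 ^ N := pow_le_pow_right₀ one_le_two (by omega)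
      have hb : (H + σ) * 2 ^ k ≤ R / 20 := le_trans (by gcongr) hHR
      have p0 : 0 < H + σ := by positivity
      have p1 : 0 < (H + σ) * 2 ^ k := by positivity
      have hstep := h.norm_sub_lt_of_densityDist_le hd hσ (gm _ (hT k))
        (by rw [mul_sub_one] at i3; linarith)
        (i2.trans hb) (gm _ (hT (k + 1))) (by rw [gd _ (hT k) _ (hT (k + 1))]; exact hT1 k)
      set w := g (T k)
      set w' := g (T (k + 1))
      have r1 := (abs_re_le_norm (w' - w)).trans hstep.le
      have r2 := (abs_im_le_norm (w' - w)).trans hstep.le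
      rw [sub_re] at r1
      rw [sub_im] at r2
      have a1 : |w'.im| ≤ |w.im| + |w'.im - w.im| := by
        have := abs_add_le w.im (w'.im - w.im); rwa [add_sub_cancel] at this
      have a2 : |w.im| ≤ |w'.im| + |w'.im - w.im| := by
        have := abs_sub w'.im (w'.im - w.im)
        rwa [sub_sub_cancel] at this
      have a3 : |w'.re - R| ≤ |w.re - R| + |w'.re - w.re| := by
        rw [← sub_add_sub_cancel w'.re w.re R, add_comm |w.re - R|]
        exact abs_add_le _ _
      have hp : (0:ℝ) < 2 ^ k := by positivity
      rw [pow_succ]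
      refine ⟨?_, ?_, ?_⟩
      · nlinarith
      · nlinarith
      · nlinarith
  obtain ⟨k1, -, -⟩ := key N le_rfl
  have hTN : T N = L := min_eq_right hcon
  rw [hTN, g1, hui, abs_zero, zero_add] at k1
  linarith

end IsLandauDensity

namespace IsLandauDensity

variable {Ω : Set ℂ} {ρ : ℂ → ℝ} {c R σ H : ℝ} {x y p q u w e e' z : ℂ} {g : ℝ → ℂ}

lemma infDist_pos (h : IsLandauDensity Ω ρ c) (hne : Ωᶜ.Nonempty) (hz : z ∈ Ω) :
    0 < infDist z Ωᶜ :=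
  (h.admissible.isOpen.isClosed_compl.notMem_iff_infDist_pos hne).1 (not_not.2 hz)

lemma densityDist_add_I_le (h : IsLandauDensity Ω ρ c) (hreal : ∀ e ∈ Ωᶜ, e.im = 0)
    (hne : Ωᶜ.Nonempty) (hp : p ∈ Ω) (hpi : 0 ≤ p.im) (hR : 0 < R) (hpR : infDist p Ωᶜ ≤ R) :
    p + R * I ∈ Ω ∧ densityDist Ω ρ p (p + R * I) ≤ 3 * Real.log (2 * R / infDist p Ωᶜ) := by
  have hδ := h.infDist_pos hne hp
  set δ := infDist p Ωᶜ with hδdef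
  have hseg : ∀ t : ℝ, p + t • (R * I) ∈ Ω ∨ t < 0 ∨ t = 0 := by
    intro t
    by_contra! hcon
    have := hreal _ hcon.1
    simp only [add_im, real_smul, mul_im, ofReal_re, I_im, mul_one, ofReal_im, I_re, mul_zero,
      add_zero, zero_mul] at this
    have : 0 < t * R := mul_pos (lt_of_le_of_ne hcon.2.1 (Ne.symm hcon.2.2)) hR
    linarith
  have hS : ∀ t ∈ Icc (0:ℝ) 1, p + t • (R * I) ∈ Ω := by
    intro t ht
    rcases hseg t with h1 | h1 | h1
    · exact h1
    · exact absurd ht.1 (not_le.2 h1)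
    · simpa [h1] using hp
  refine ⟨by simpa using hS 1 (by simp), ?_⟩
  have hpos : ∀ t ∈ Icc (0:ℝ) 1, 0 < δ + t * R := fun t ht => by
    have := mul_nonneg ht.1 hR.le
    linarith
  have := densityDist_le_of_segment h.admissible.continuousOn h.admissible.pos (x := p)
    (v := R * I) (f := fun t => 3 * R / (δ + t * R))
    (continuousOn_const.div (by fun_prop) fun t ht => (hpos t ht).ne') hS ?_
  · refine this.trans ?_
    have hd : ∀ t ∈ uIcc (0:ℝ) 1, HasDerivAt (fun t => 3 * Real.log (δ + t * R))
        (3 * R / (δ + t * R)) t := by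
      intro t ht
      rw [uIcc_of_le zero_le_one] at ht
      have h1 : HasDerivAt (fun t => δ + t * R) (1 * R) t :=
        ((hasDerivAt_id t).mul_const R).const_add δ
      have := (h1.log (hpos t ht).ne').const_mul 3
      rwa [one_mul, mul_div_assoc'] at this
    rw [intervalIntegral.integral_eq_sub_of_hasDerivAt hd]
    · simp only [one_mul, zero_mul, add_zero]
      rw [← mul_sub, ← Real.log_div (by positivity) hδ.ne']
      gcongr
      linarith
    · refine ContinuousOn.intervalIntegrable ?_
      rw [uIcc_of_le zero_le_one]
      exact continuousOn_const.div (by fun_prop) fun t ht => (hpos t ht).ne'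
  · intro t ht
    have hn : ‖(R:ℂ) * I‖ = R := by simp [abs_of_pos hR]
    have hlow : 2 / 3 * (δ + t * R) ≤ infDist (p + t • (R * I)) Ωᶜ := by
      refine (le_infDist hne).2 fun e he => ?_
      have h1 : δ ≤ ‖p - e‖ := by rw [← dist_eq_norm]; exact infDist_le_dist_of_mem he
      have hei := hreal e he
      rw [dist_eq_norm]
      refine le_of_sq_le_sq ?_ (norm_nonneg _)
      have e1 : ‖p - e‖ ^ 2 = (p.re - e.re) ^ 2 + p.im ^ 2 := by
        rw [Complex.sq_norm, normSq_apply]; simp [hei]; ring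
      have e2 : ‖p + t • (R * I) - e‖ ^ 2 = (p.re - e.re) ^ 2 + (p.im + t * R) ^ 2 := by
        rw [Complex.sq_norm, normSq_apply]; simp [hei]; ring
      have h2 : δ ^ 2 ≤ (p.re - e.re) ^ 2 + p.im ^ 2 := by rw [← e1]; gcongr
      rw [e2]
      have h3 := mul_nonneg ht.1 hR.le
      nlinarith [mul_nonneg hpi h3, sq_nonneg (δ - t * R)]
    have hz := h.mul_infDist_le _ (hS t ht)
    rw [hn, mul_div_right_comm]
    gcongr
    rw [le_div_iff₀ (hpos t ht)]
    have hρ := (h.admissible.pos _ (hS t ht)).le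
    nlinarith [mul_le_mul_of_nonneg_left hlow hρ]

lemma densityDist_le_log (h : IsLandauDensity Ω ρ c) (hreal : ∀ e ∈ Ωᶜ, e.im = 0)
    (hne : Ωᶜ.Nonempty) (hp : p ∈ Ω) (hpi : 0 ≤ p.im) (hq : q ∈ Ω) (hqi : 0 ≤ q.im) (hR : 0 < R)
    (hpR : infDist p Ωᶜ ≤ R) (hqR : infDist q Ωᶜ ≤ R) (hpq : ‖q - p‖ ≤ R) :
    densityDist Ω ρ p q ≤
      3 * Real.log (2 * R / infDist p Ωᶜ) + 3 * Real.log (2 * R / infDist q Ωᶜ) + 2 := by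
  obtain ⟨p1, p2⟩ := h.densityDist_add_I_le hreal hne hp hpi hR hpR
  obtain ⟨q1, q2⟩ := h.densityDist_add_I_le hreal hne hq hqi hR hqR
  set p' := p + R * I with hp'
  set q' := q + R * I with hq'
  have hhigh : ∀ t ∈ Icc (0:ℝ) 1, R ≤ (p' + t • (q' - p')).im := by
    intro t ht
    have : (p' + t • (q' - p')).im = (1 - t) * p.im + t * q.im + R := by
      simp [hp', hq']; ring
    rw [this]
    have := mul_nonneg (sub_nonneg.2 ht.2) hpi
    have := mul_nonneg ht.1 hqi
    linarith
  have hS : ∀ t ∈ Icc (0:ℝ) 1, p' + t • (q' - p') ∈ Ω := by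
    intro t ht
    by_contra hcon
    linarith [hhigh t ht, hreal _ hcon]
  have hmid := densityDist_le_mul_norm h.admissible.continuousOn h.admissible.pos (C := 2 / R) hS
    (fun t ht => by
      have hz := h.mul_infDist_le _ (hS t ht)
      have hlow : R ≤ infDist (p' + t • (q' - p')) Ωᶜ := by
        refine (le_infDist hne).2 fun e he => ?_
        rw [dist_eq_norm]
        have := abs_im_le_norm (p' + t • (q' - p') - e)
        rw [sub_im, hreal e he, sub_zero] at this
        exact ((hhigh t ht).trans (le_abs_self _)).trans this
      rw [le_div_iff₀ hR]
      have hρ := (h.admissible.pos _ (hS t ht)).le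
      nlinarith [mul_le_mul_of_nonneg_left hlow hρ])
  rw [add_sub_cancel] at hmid
  have hn : ‖q' - p'‖ = ‖q - p‖ := by simp [hp', hq']
  have hmid2 : densityDist Ω ρ p' q' ≤ 2 := by
    refine hmid.trans ?_
    rw [hn, div_mul_eq_mul_div, div_le_iff₀ hR]
    linarith
  have t1 := h.admissible.triangle hp p1 hq
  have t2 := h.admissible.triangle p1 q1 hq
  rw [h.admissible.comm q1 hq] at t2
  linarith

/-- Near a scale at which the complement is dense, the density is bounded below in terms of the
distance to the complement. -/
lemma sq_le_mul_infDist (h : IsLandauDensity Ω ρ c) (hreal : ∀ e ∈ Ωᶜ, e.im = 0)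
    (hd : HasDenseComplementAt Ω R σ) (hσ : 0 < σ) (hz : z ∈ Ω) (hzre : |z.re - R| ≤ R / 8)
    (hzR : |z.im| + σ ≤ R / 16) :
    infDist z Ωᶜ ≤ |z.im| + σ ∧ c ^ 2 ≤ ρ z ^ 2 * (4 * (infDist z Ωᶜ * R)) := by
  have hre := abs_le.1 hzre
  have hi := abs_nonneg z.im
  obtain ⟨t₀, ht₀, h₀⟩ := hd z.re ⟨by linarith, by linarith⟩
  have hδ : infDist z Ωᶜ ≤ |z.im| + σ := by
    refine (infDist_le_dist_of_mem ht₀).trans ?_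
    rw [dist_eq_norm]
    exact (norm_sub_ofReal_le z t₀).trans (by gcongr)
  refine ⟨hδ, ?_⟩
  obtain ⟨e, he, hze⟩ := h.admissible.isOpen.isClosed_compl.exists_infDist_eq_dist ⟨_, ht₀⟩ z
  rw [dist_eq_norm] at hze
  have her : e = (e.re : ℂ) := by apply Complex.ext <;> simp [hreal e he]
  have h1 := abs_re_le_norm (z - e)
  rw [← hze, sub_re] at h1
  have h1' := abs_le.1 (h1.trans hδ)
  obtain ⟨t, ht, htu⟩ := hd (e.re + R / 8) ⟨by linarith, by linarith⟩
  have htu' := abs_le.1 htu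
  have hpos : 0 < t - e.re := by linarith
  have hn : ‖(t : ℂ) - e‖ = t - e.re := by
    rw [her, ← ofReal_sub, norm_real, Real.norm_of_nonneg (by simpa using hpos.le)]; simp
  refine (h.sq_le_mul_dist hz he ht ?_).trans ?_
  · rw [← hze, hn]; linarith
  · rw [← hze, hn]
    have := infDist_nonneg (x := z) (s := Ωᶜ)
    gcongr
    linarith

end IsLandauDensity

namespace IsLandauDensity

variable {Ω : Set ℂ} {ρ : ℂ → ℝ} {c R σ H : ℝ} {x y p q u w e e' z : ℂ} {g : ℝ → ℂ}

lemma infDist_mul_infDist_le (h : IsLandauDensity Ω ρ c) (hreal : ∀ e ∈ Ωᶜ, e.im = 0)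
    (hne : Ωᶜ.Nonempty) (hp : p ∈ Ω) (hpi : 0 ≤ p.im) (hq : q ∈ Ω) (hqi : 0 ≤ q.im) (hR : 0 < R)
    (hpR : infDist p Ωᶜ ≤ R) (hqR : infDist q Ωᶜ ≤ R) (hpq : ‖q - p‖ ≤ R) :
    infDist p Ωᶜ * infDist q Ωᶜ ≤ 16 * R ^ 2 * Real.exp (-(densityDist Ω ρ p q / 3)) := by
  have key := h.densityDist_le_log hreal hne hp hpi hq hqi hR hpR hqR hpq
  have h1 := h.infDist_pos hne hp
  have h2 := h.infDist_pos hne hq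
  set δ₁ := infDist p Ωᶜ
  set δ₂ := infDist q Ωᶜ
  set D := densityDist Ω ρ p q
  have e1 : D / 3 - 1 ≤ Real.log (2 * R / δ₁ * (2 * R / δ₂)) := by
    rw [Real.log_mul (by positivity) (by positivity)]
    linarith
  rw [Real.le_log_iff_exp_le (by positivity), Real.exp_sub, div_mul_div_comm,
    div_le_div_iff₀ (Real.exp_pos 1) (by positivity)] at e1
  rw [Real.exp_neg, ← div_eq_mul_inv, le_div_iff₀ (Real.exp_pos _)]
  have e2 : Real.exp 1 ≤ 4 := by linarith [Real.exp_one_lt_d9]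
  have e3 : 2 * R * (2 * R) * Real.exp 1 ≤ 2 * R * (2 * R) * 4 := by gcongr
  linarith

/-- A geodesic of the upper half plane which stays at small height over a scale at which the
complement is dense has small displacement. -/
lemma norm_sub_le_of_im_le (h : IsLandauDensity Ω ρ c) (hreal : ∀ e ∈ Ωᶜ, e.im = 0)
    (hd : HasDenseComplementAt Ω R σ) (hσ : 0 < σ) (hσH : σ ≤ H) (hHR : H + σ ≤ R / 16)
    {κ : ℝ} (hκ : 0 < κ) (hκH : 8 * H ≤ κ ^ 4 * R)
    (hg : IsGeodesicIn Ω (densityDist Ω ρ) g x y) {t₁ : ℝ}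
    (ht₁ : t₁ ∈ Icc 0 (densityDist Ω ρ x y))
    (him : ∀ t ∈ Icc 0 t₁, 0 ≤ (g t).im) (himH : ∀ t ∈ Icc 0 t₁, (g t).im ≤ H)
    (hre : ∀ t ∈ Icc 0 t₁, |(g t).re - R| ≤ R / 8) :
    ‖g t₁ - g 0‖ ≤ 96 * κ * R / c := by
  have hR : 0 < R := by linarith
  have hc := h.const_pos
  have hsub : Icc 0 t₁ ⊆ Icc 0 (densityDist Ω ρ x y) := Icc_subset_Icc_right ht₁.2
  have hne : (Ωᶜ).Nonempty := by
    obtain ⟨t, ht, -⟩ := hd R ⟨by linarith, by linarith⟩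
    exact ⟨_, ht⟩
  have himσ : ∀ t ∈ Icc 0 t₁, |(g t).im| + σ ≤ R / 16 := fun t ht => by
    rw [abs_of_nonneg (him t ht)]; linarith [himH t ht]
  have hmem : ∀ t ∈ Icc 0 t₁, g t ∈ Ω := fun t ht => hg.2.2.1 t (hsub ht)
  have hδ : ∀ t ∈ Icc 0 t₁, infDist (g t) Ωᶜ ≤ 2 * H := fun t ht => by
    have := (h.sq_le_mul_infDist hreal hd hσ (hmem t ht) (hre t ht) (himσ t ht)).1
    rw [abs_of_nonneg (him t ht)] at this
    linarith [himH t ht]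
  obtain ⟨s, hs, hmax⟩ := isCompact_Icc.exists_isMaxOn (nonempty_Icc.2 ht₁.1)
    ((continuous_infDist_pt Ωᶜ).comp_continuousOn
      ((h.admissible.continuousOn_geodesic hg).mono hsub))
  set M := infDist (g s) Ωᶜ
  have hM : 0 < M := h.infDist_pos hne (hmem s hs)
  have hspeed : ∀ t ∈ Icc 0 t₁, (ρ (g t))⁻¹ ≤ 2 * κ * R / c * Real.exp (-|t - s| / 24) := by
    intro t ht
    have hρ := h.admissible.pos _ (hmem t ht)
    have hδt := h.infDist_pos hne (hmem t ht)
    have hle : infDist (g t) Ωᶜ ≤ M := hmax ht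
    have b1 := h.infDist_mul_infDist_le hreal hne (hmem t ht) (him t ht) (hmem s hs) (him s hs) hR
      (by linarith [hδ t ht]) (by linarith [hδ s hs]) (by
        refine (norm_le_abs_re_add_abs_im _).trans ?_
        have i1 := abs_le.1 (hre t ht)
        have i2 := abs_le.1 (hre s hs)
        rw [sub_re, sub_im]
        have i3 : |(g s).re - (g t).re| ≤ R / 4 := abs_le.2 ⟨by linarith, by linarith⟩
        have i4 : |(g s).im - (g t).im| ≤ H :=
          abs_le.2 ⟨by linarith [himH t ht, him s hs], by linarith [him t ht, himH s hs]⟩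
        linarith)
    rw [hg.2.2.2 t (hsub ht) s (hsub hs)] at b1
    have b2 := (h.sq_le_mul_infDist hreal hd hσ (hmem t ht) (hre t ht) (himσ t ht)).2
    set δ := infDist (g t) Ωᶜ
    set E := Real.exp (-|t - s| / 24)
    have hE : 0 < E := Real.exp_pos _
    have hE8 : Real.exp (-(|t - s| / 3)) = E ^ 8 := by
      rw [← Real.exp_nat_mul]; congr 1; push_cast; ring
    rw [hE8] at b1
    have b3 : δ ^ 2 ≤ 4 * M * R * E ^ 4 := by
      refine le_of_sq_le_sq ?_ (by positivity)
      calc (δ ^ 2) ^ 2 = δ * δ * δ ^ 2 := by ring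
        _ ≤ δ * M * M ^ 2 := by gcongr
        _ ≤ 16 * R ^ 2 * E ^ 8 * M ^ 2 := by gcongr
        _ = _ := by ring
    have b4 : c ^ 4 ≤ ρ (g t) ^ 4 * (2 * κ * R * E) ^ 4 := by
      calc c ^ 4 = (c ^ 2) ^ 2 := by ring
        _ ≤ (ρ (g t) ^ 2 * (4 * (δ * R))) ^ 2 := by gcongr
        _ = ρ (g t) ^ 4 * (16 * R ^ 2) * δ ^ 2 := by ring
        _ ≤ ρ (g t) ^ 4 * (16 * R ^ 2) * (4 * M * R * E ^ 4) := by gcongr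
        _ = ρ (g t) ^ 4 * (16 * R ^ 3 * E ^ 4) * (4 * M) := by ring
        _ ≤ ρ (g t) ^ 4 * (16 * R ^ 3 * E ^ 4) * (κ ^ 4 * R) :=
          mul_le_mul_of_nonneg_left (by linarith [hδ s hs]) (by positivity)
        _ = _ := by ring
    rw [← mul_pow] at b4
    have b5 := le_of_pow_le_pow_left₀ (by norm_num) (by positivity) b4
    rw [inv_le_iff_one_le_mul₀ hρ, div_mul_eq_mul_div, div_mul_eq_mul_div, one_le_div hc]
    linarith
  set V := 2 * κ * R / c
  have hV : 0 < V := by positivity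
  have hB : ∀ t, HasDerivAt (fun t => 24 * V * Real.exp ((t - s) / 24))
      (V * Real.exp ((t - s) / 24)) t := by
    intro t
    have h1 : HasDerivAt (fun t : ℝ => (t - s) / 24) (1 / 24) t :=
      ((hasDerivAt_id t).sub_const s).div_const 24
    exact (h1.exp.const_mul (24 * V)).congr_deriv (by ring)
  have hB' : ∀ t, HasDerivAt (fun t => -(24 * V) * Real.exp (-(t - s) / 24))
      (V * Real.exp (-(t - s) / 24)) t := by
    intro t
    have h1 : HasDerivAt (fun t : ℝ => -(t - s) / 24) (-1 / 24) t :=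
      ((hasDerivAt_id t).sub_const s).neg.div_const 24
    exact (h1.exp.const_mul (-(24 * V))).congr_deriv (by ring)
  have n1 := h.admissible.norm_sub_le_of_geodesic hg hs.1 le_rfl (hs.2.trans ht₁.2) hB
    (fun t ht => by
      have := hspeed t ⟨ht.1, ht.2.trans hs.2⟩
      rwa [abs_of_nonpos (sub_nonpos.2 ht.2), neg_neg] at this)
  have n2 := h.admissible.norm_sub_le_of_geodesic hg hs.2 hs.1 ht₁.2 hB'
    (fun t ht => by
      have := hspeed t ⟨hs.1.trans ht.1, ht.2⟩
      rwa [abs_of_nonneg (sub_nonneg.2 ht.1)] at this)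
  simp only [sub_self, zero_div, neg_zero, Real.exp_zero, mul_one] at n1 n2
  have p1 : 0 < 24 * V * Real.exp ((0 - s) / 24) := by positivity
  have p2 : 0 < 24 * V * Real.exp (-(t₁ - s) / 24) := by positivity
  have := norm_sub_le_norm_sub_add_norm_sub (g t₁) (g s) (g 0)
  have hVe : 96 * κ * R / c = 48 * V := by simp only [V]; ring
  rw [hVe]
  linarith

/-- A reflection invariant Landau density whose complement becomes dense at arbitrarily large
scales does not induce a Gromov hyperbolic distance. -/
theorem not_isGromovHyperbolic (h : IsLandauDensity Ω ρ c) (hs : IsConjInvariant Ω ρ)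
    (hreal : ∀ e ∈ Ωᶜ, e.im = 0)
    (hscale : ∀ ε > 0, ∃ R > 0, HasDenseComplementAt Ω R (ε * R) ∧
      ∃ x ∈ Ω, ∃ y ∈ Ω, x.im = 0 ∧ y.im = 0 ∧ |x.re - R| ≤ R / 16 ∧ 2 * R ≤ y.re) :
    ¬ IsGromovHyperbolic Ω (densityDist Ω ρ) := by
  rintro ⟨δ, hδ0, hyp⟩
  have hc := h.const_pos
  have hκ : 0 < (c / 2000) ^ 4 := by positivity
  obtain ⟨N, hN1, hN2⟩ : ∃ N : ℕ, (δ + 1) / (c / 9) ≤ N ∧ (1 / 2 : ℝ) ^ N ≤ (c / 2000) ^ 4 := by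
    have t1 := tendsto_natCast_atTop_atTop.eventually_ge_atTop ((δ + 1) / (c / 9))
    have t2 := (tendsto_pow_atTop_nhds_zero_of_lt_one (r := (1 / 2 : ℝ)) (by norm_num)
      (by norm_num)).eventually_le_const hκ
    exact (t1.and t2).exists
  set P : ℝ := 2 ^ N
  have hP : 1 ≤ P := one_le_pow₀ one_le_two
  have hPinv : (1 / 2 : ℝ) ^ N = 1 / P := by simp [P]
  rw [hPinv] at hN2
  obtain ⟨R, hR, hd, x, hx, y, hy, hxi, hyi, hxR, hyR⟩ := hscale (1 / (80 * P * P)) (by positivity)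
  set σ := 1 / (80 * P * P) * R
  have hσ : 0 < σ := by positivity
  set H := R / (40 * P) with hH
  have hHpos : 0 < H := by positivity
  have hHP : H * P = R / 40 := by rw [hH]; field_simp
  have hσP : σ * P = H / 2 := by simp only [σ, hH]; field_simp; norm_num
  have hσH : σ ≤ H := by nlinarith
  have hHR : H + σ ≤ R / 16 := by nlinarith
  obtain ⟨e₁, he₁, e₂, he₂, hne⟩ : ∃ e₁ ∈ Ωᶜ, ∃ e₂ ∈ Ωᶜ, e₁ ≠ e₂ := by
    obtain ⟨t, ht, htR⟩ := hd (R / 2) ⟨by linarith, by linarith⟩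
    obtain ⟨t', ht', htR'⟩ := hd (3 * R / 2) ⟨by linarith, by linarith⟩
    refine ⟨t, ht, t', ht', fun heq => ?_⟩
    rw [ofReal_inj] at heq
    rw [abs_le] at htR htR'
    linarith
  have hgeo : ∀ x ∈ Ω, ∀ y ∈ Ω, ∃ g, IsGeodesicIn Ω (densityDist Ω ρ) g x y :=
    fun x hx y hy => h.exists_isGeodesicIn he₁ he₂ hne hx hy
  obtain ⟨g₀, hg₀⟩ := hgeo x hx y hy
  have hg := hs.isGeodesicIn_foldUp h.admissible hxi hyi hg₀
  set g := fun t => foldUp (g₀ t)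
  have hup : ∀ t, 0 ≤ (g t).im := fun t => abs_nonneg _
  set L := densityDist Ω ρ x y with hLdef
  have hL : 0 ≤ L := h.admissible.nonneg
  have hcont := h.admissible.continuousOn_geodesic hg
  have hcre : ContinuousOn (fun t => |(g t).re - R|) (Icc 0 L) :=
    ((Complex.continuous_re.comp_continuousOn hcont).sub continuousOn_const).abs
  have hcim : ContinuousOn (fun t => (g t).im) (Icc 0 L) :=
    Complex.continuous_im.comp_continuousOn hcont
  have hend : R / 8 ≤ |(g L).re - R| := by
    rw [hg.2.1]; exact le_trans (by linarith) (le_abs_self _)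
  have hstart : |(g 0).re - R| ≤ R / 16 := by rwa [hg.1]
  obtain ⟨t₁, ⟨ht₁I, ht₁⟩, hleast⟩ : ∃ t, IsLeast (Icc 0 L ∩ (fun t => |(g t).re - R|) ⁻¹' {R / 8})
      t := by
    refine IsCompact.exists_isLeast ?_ ?_
    · exact isCompact_Icc.of_isClosed_subset
        (hcre.preimage_isClosed_of_isClosed isClosed_Icc isClosed_singleton) inter_subset_left
    · obtain ⟨t, ht, he⟩ := intermediate_value_Icc hL hcre
        (show R / 8 ∈ _ from ⟨by linarith, hend⟩)
      exact ⟨t, ht, he⟩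
  have hsub : Icc 0 t₁ ⊆ Icc 0 L := Icc_subset_Icc_right ht₁I.2
  simp only [mem_preimage, mem_singleton_iff] at ht₁
  have hre : ∀ t ∈ Icc 0 t₁, |(g t).re - R| ≤ R / 8 := by
    intro t ht
    by_contra! hcon
    obtain ⟨t', ht', he⟩ := intermediate_value_Icc ht.1
      (hcre.mono (Icc_subset_Icc_right (hsub ht).2)) (show R / 8 ∈ _ from ⟨by linarith, hcon.le⟩)
    have h1 := hleast ⟨⟨ht'.1, ht'.2.trans (hsub ht).2⟩, he⟩
    have h2 : t = t' := le_antisymm (ht.2.trans h1) ht'.2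
    simp only [← h2] at he
    linarith
  have himne : ∀ t ∈ Icc 0 t₁, (g t).im ≠ H := by
    intro t ht heq
    obtain ⟨u, hu, hui, hlt⟩ := hs.exists_real_near h.admissible hyp hxi hyi hg
      (fun t _ => hup t) (hsub ht)
    have := h.lt_densityDist_of_im_eq_zero hd hσ hgeo (N := N) hHpos
      (by change (H + σ) * P ≤ _; nlinarith) (by change σ * P < _; linarith)
      (hg.2.2.1 t (hsub ht)) (hre t ht) heq hu hui
    rw [div_le_iff₀ (by positivity)] at hN1
    linarith
  have himH : ∀ t ∈ Icc 0 t₁, (g t).im ≤ H := by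
    intro t ht
    by_contra! hcon
    obtain ⟨t', ht', he⟩ := intermediate_value_Icc ht.1
      (hcim.mono (Icc_subset_Icc_right (hsub ht).2))
      (show H ∈ _ from ⟨by simp only [hg.1, hxi]; exact hHpos.le, hcon.le⟩)
    exact himne t' ⟨ht'.1, ht'.2.trans ht.2⟩ he
  have hfin := h.norm_sub_le_of_im_le hreal hd hσ hσH hHR (κ := c / 2000) (by positivity) (by
      have : 8 * H = 1 / P / 5 * R := by rw [hH]; field_simp; norm_num
      rw [this]
      gcongr
      have : 0 < 1 / P := by positivity
      linarith) hg ht₁I (fun t _ => hup t) himH hre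
  have e1 : 96 * (c / 2000) * R / c = 96 / 2000 * R := by field_simp
  rw [e1] at hfin
  have h1 := (abs_re_le_norm (g t₁ - g 0)).trans hfin
  rw [sub_re] at h1
  have h2 := abs_sub_abs_le_abs_sub ((g t₁).re - R) ((g 0).re - R)
  rw [sub_sub_sub_cancel_right, ht₁] at h2
  linarith

end IsLandauDensity

section Denjoy

variable {Ω : Set ℂ} {a b : ℕ → ℝ} {G : ℝ → ℝ}

/-- A Denjoy domain meeting the real axis contains every non-real point. -/
lemma IsDenjoyDomain.im_eq_zero_of_mem_compl (hΩ : IsDenjoyDomain Ω) {x : ℝ} (hx : (x : ℂ) ∈ Ω) :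
    ∀ e ∈ Ωᶜ, e.im = 0 := by
  obtain ⟨ho, -, hf⟩ := hΩ
  obtain ⟨r, hr, hb⟩ := Metric.isOpen_iff.1 ho x hx
  have key : ∀ U : Set ℂ, IsPreconnected U → (∀ z ∈ U, z.im ≠ 0) → (U ∩ Ω).Nonempty → U ⊆ Ω := by
    intro U hU hne hUint
    refine hU.subset_left_of_subset_union ho isClosed_closure.isOpen_compl
      (disjoint_compl_right.mono_left subset_closure) (fun z hz => ?_) hUint
    by_contra hcon
    rw [mem_union, not_or, mem_compl_iff, not_not] at hcon
    exact hne z hz (hf (ho.frontier_eq ▸ ⟨hcon.2, hcon.1⟩))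
  have hmem : ∀ s : ℝ, |s| < r → (x : ℂ) + s * I ∈ Ω := fun s hs => hb (by
    rw [mem_ball_iff_norm]; simpa using hs)
  have hup : {z : ℂ | 0 < z.im} ⊆ Ω := key _ (convex_halfSpace_im_gt 0).isPreconnected
    (fun z hz => ne_of_gt hz) ⟨_, by simpa using half_pos hr, hmem (r / 2)
      (by rw [abs_of_pos (half_pos hr)]; linarith)⟩
  have hlow : {z : ℂ | z.im < 0} ⊆ Ω := key _ (convex_halfSpace_im_lt 0).isPreconnected
    (fun z hz => ne_of_lt hz) ⟨x + (-(r / 2) : ℝ) * I, by simpa using hr, hmem _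
      (by rw [abs_neg, abs_of_pos (half_pos hr)]; linarith)⟩
  intro e he
  by_contra hne
  rcases lt_or_gt_of_ne hne with h | h
  · exact he (hlow h)
  · exact he (hup h)

lemma ofReal_left_mem_compl (hab : ∀ n, a n < b n)
    (hdisj : Pairwise (Function.onFun Disjoint fun n => Ioo (a n) (b n)))
    (hre : (fun x : ℝ => (x : ℂ)) ⁻¹' Ω = ⋃ n, Ioo (a n) (b n)) (n : ℕ) : (a n : ℂ) ∈ Ωᶜ := by
  intro hmem
  have : a n ∈ ⋃ n, Ioo (a n) (b n) := hre ▸ hmem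
  obtain ⟨m, hm⟩ := mem_iUnion.1 this
  have hne : m ≠ n := by rintro rfl; exact lt_irrefl _ hm.1
  obtain ⟨x, hx1, hx2⟩ := exists_between (lt_min hm.2 (hab n))
  exact Set.disjoint_left.1 (hdisj hne) ⟨hm.1.trans hx1, hx2.trans_le (min_le_left _ _)⟩
    ⟨hx1, hx2.trans_le (min_le_right _ _)⟩

lemma exists_hasDenseComplementAt (hab : ∀ n, a n < b n)
    (hdisj : Pairwise (Function.onFun Disjoint fun n => Ioo (a n) (b n)))
    (hre : (fun x : ℝ => (x : ℂ)) ⁻¹' Ω = ⋃ n, Ioo (a n) (b n))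
    (hlimsup : ∀ M : ℝ, ∃ᶠ n in Filter.atTop, M < a n)
    (hG0 : Filter.Tendsto G Filter.atTop (nhds 0))
    (hgap : ∀ n, 0 < a n → b n - a n ≤ a n * G (a n)) {ε : ℝ} (hε : 0 < ε) :
    ∃ R > 0, HasDenseComplementAt Ω R (ε * R) ∧
      ∃ x ∈ Ω, ∃ y ∈ Ω, x.im = 0 ∧ y.im = 0 ∧ |x.re - R| ≤ R / 16 ∧ 2 * R ≤ y.re := by
  have hmem : ∀ n, ∀ x ∈ Ioo (a n) (b n), (x : ℂ) ∈ Ω := by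
    intro n x hx
    have : x ∈ (fun x : ℝ => (x : ℂ)) ⁻¹' Ω := hre ▸ mem_iUnion.2 ⟨n, hx⟩
    exact this
  set η := min (ε / 2) (1 / 16)
  have hη : 0 < η := lt_min (half_pos hε) (by norm_num)
  obtain ⟨M, hM⟩ := eventually_atTop.1 (hG0.eventually_le_const hη)
  obtain ⟨n₀, hn₀⟩ := (hlimsup (max M 1)).exists
  have hn₀1 : 1 < a n₀ := (le_max_right _ _).trans_lt hn₀
  obtain ⟨n, hn⟩ := (hlimsup (2 * b n₀)).exists
  have hR : 0 < a n := by linarith [hab n₀]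
  have hlen : ∀ m, a n₀ ≤ a m → b m - a m ≤ a m * η := by
    intro m hm
    refine (hgap m (by linarith)).trans (mul_le_mul_of_nonneg_left (hM _ ?_) (by linarith))
    exact ((le_max_left _ _).trans hn₀.le).trans hm
  obtain ⟨k, hk⟩ := (hlimsup (2 * a n)).exists
  obtain ⟨x, hx⟩ := exists_between (hab n)
  obtain ⟨y, hy⟩ := exists_between (hab k)
  refine ⟨a n, hR, ?_, x, hmem n x hx, y, hmem k y hy, ofReal_im x, ofReal_im y, ?_, ?_⟩
  · intro u hu
    by_cases huΩ : (u : ℂ) ∈ Ω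
    · have : u ∈ ⋃ n, Ioo (a n) (b n) := hre ▸ huΩ
      obtain ⟨m, hm⟩ := mem_iUnion.1 this
      refine ⟨a m, ofReal_left_mem_compl hab hdisj hre m, ?_⟩
      have ham : a n₀ ≤ a m := by
        by_contra! hcon
        have hne : m ≠ n₀ := by rintro rfl; exact lt_irrefl _ hcon
        obtain ⟨v, hv⟩ := exists_between (hab n₀)
        exact Set.disjoint_left.1 (hdisj hne) ⟨hcon.trans hv.1, by linarith [hv.2, hm.2, hu.1]⟩ hv
      rw [abs_sub_comm, abs_of_pos (sub_pos.2 hm.1)]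
      have h1 := hlen m ham
      have h2 : a m * η ≤ (3 * a n / 2) * (ε / 2) := by
        have := hm.1.le.trans hu.2
        gcongr
        exact min_le_left _ _
      nlinarith [hm.2, mul_pos hR hε]
    · refine ⟨u, huΩ, ?_⟩
      rw [sub_self, abs_zero]
      positivity
  · rw [ofReal_re, abs_of_pos (sub_pos.2 hx.1)]
    have h1 := hlen n (by linarith [hab n₀])
    have h2 : a n * η ≤ a n * (1 / 16) := by gcongr; exact min_le_right _ _
    linarith [hx.2]
  · rw [ofReal_re]
    linarith [hy.1]

/-- A Landau density on a Denjoy domain with asymptotically small gaps does not induce a Gromov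
hyperbolic distance. -/
theorem IsLandauDensity.not_isGromovHyperbolic_of_small_gaps {ρ : ℂ → ℝ} {c : ℝ}
    (h : IsLandauDensity Ω ρ c) (hconj : ∀ z ∈ Ω, ρ ((starRingEnd ℂ) z) = ρ z)
    (hΩ : IsDenjoyDomain Ω) (hab : ∀ n, a n < b n)
    (hdisj : Pairwise (Function.onFun Disjoint fun n => Ioo (a n) (b n)))
    (hre : (fun x : ℝ => (x : ℂ)) ⁻¹' Ω = ⋃ n, Ioo (a n) (b n))
    (hlimsup : ∀ M : ℝ, ∃ᶠ n in Filter.atTop, M < a n)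
    (hG0 : Filter.Tendsto G Filter.atTop (nhds 0))
    (hgap : ∀ n, 0 < a n → b n - a n ≤ a n * G (a n)) :
    ¬ IsGromovHyperbolic Ω (densityDist Ω ρ) := by
  have hscale := fun ε (hε : ε > 0) =>
    exists_hasDenseComplementAt hab hdisj hre hlimsup hG0 hgap hε
  obtain ⟨R, -, -, x, hx, -, -, hxi, -⟩ := hscale 1 one_pos
  have hreal := hΩ.im_eq_zero_of_mem_compl (x := x.re)
    (by rwa [show (x.re : ℂ) = x from Complex.ext (by simp) (by simp [hxi])])
  refine h.not_isGromovHyperbolic ⟨fun z hz => ?_, hconj⟩ hreal hscale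
  by_contra hcon
  have h0 := hreal _ hcon
  rw [conj_im, neg_eq_zero] at h0
  exact hcon (by rwa [conj_of_im_eq_zero h0])

lemma isLandauDensity_qhDensity (ho : IsOpen Ω) (hc : IsPreconnected Ω) (hne : Ωᶜ.Nonempty) :
    IsLandauDensity Ω (qhDensity Ω) 1 := by
  have hpos : ∀ z ∈ Ω, 0 < infDist z Ωᶜ := fun z hz =>
    (ho.isClosed_compl.notMem_iff_infDist_pos hne).1 (not_not.2 hz)
  refine ⟨⟨ho, hc, (continuous_infDist_pt _).continuousOn.inv₀ fun z hz => (hpos z hz).ne',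
    fun z hz => inv_pos.2 (hpos z hz)⟩, one_pos, fun z hz => ?_, fun z hz e he e' _ _ => ?_⟩
  · rw [qhDensity, inv_mul_cancel₀ (hpos z hz).ne']; norm_num
  · rw [qhDensity, ← div_eq_inv_mul, one_le_div (hpos z hz)]
    have h1 := infDist_le_dist_of_mem (x := z) he
    rw [dist_eq_norm] at h1
    have := mul_nonneg (norm_nonneg (z - e)) (abs_nonneg (Real.log (‖z - e‖ / ‖e' - e‖)))
    linarith

lemma qhDensity_conj (hreal : ∀ e ∈ Ωᶜ, e.im = 0) (z : ℂ) :
    qhDensity Ω ((starRingEnd ℂ) z) = qhDensity Ω z := by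
  unfold qhDensity infDist infEDist
  congr 2
  refine biInf_congr fun e he => ?_
  rw [edist_dist, edist_dist, ← dist_conj_conj, Complex.conj_conj, conj_of_im_eq_zero (hreal e he)]

end Denjoy

/-- A nonvanishing holomorphic function on a disk has a holomorphic logarithm, with a prescribed
value at a prescribed point. -/
theorem Complex.exists_log_of_differentiableOn_ball {f : ℂ → ℂ} {c w : ℂ} {r : ℝ}
    (hf : DifferentiableOn ℂ f (ball c r)) (hf0 : ∀ z ∈ ball c r, f z ≠ 0)
    (hr : 0 < r) (hw : exp w = f c) :
    ∃ L : ℂ → ℂ, DifferentiableOn ℂ L (ball c r) ∧ L c = w ∧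
      ∀ z ∈ ball c r, exp (L z) = f z := by
  have hd : DifferentiableOn ℂ (deriv f) (ball c r) := hf.deriv isOpen_ball
  obtain ⟨L, hLc, hL⟩ := (hd.div hf hf0).isExactOn_ball.with_val_at c w
  have hLd : DifferentiableOn ℂ L (ball c r) :=
    fun z hz => (hL z hz).differentiableAt.differentiableWithinAt
  refine ⟨L, hLd, hLc, fun z hz => ?_⟩
  have hc : c ∈ ball c r := mem_ball_self hr
  have hder : ∀ x ∈ ball c r, HasDerivAt (fun y => exp (-L y) * f y) 0 x := fun x hx => by
    have h1 : HasDerivAt f (deriv f x) x :=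
      (hf.differentiableAt (isOpen_ball.mem_nhds hx)).hasDerivAt
    refine ((hL x hx).neg.cexp.mul h1).congr_deriv ?_
    have := hf0 x hx
    simp only [Pi.div_apply, Pi.neg_apply]
    field_simp
    ring
  have hconst := (convex_ball c r).is_const_of_fderivWithin_eq_zero (𝕜 := ℂ)
    (f := fun y => exp (-L y) * f y)
    (fun x hx => (hder x hx).differentiableAt.differentiableWithinAt)
    (fun x hx => by
      rw [fderivWithin_of_isOpen isOpen_ball hx]
      simpa using (hder x hx).hasFDerivAt.fderiv) hz hc
  simp only [hLc, ← hw, exp_neg, inv_mul_cancel₀ (exp_ne_zero w)] at hconst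
  field_simp at hconst
  exact hconst.symm

/-- **Bloch's theorem**: the image of the unit disk contains a disk of radius comparable to the
derivative at the centre. -/
theorem Complex.exists_ball_subset_image_of_differentiableOn_ball {f : ℂ → ℂ}
    (hf : DifferentiableOn ℂ f (ball 0 1)) (h0 : deriv f 0 ≠ 0) :
    ∃ w, ball w (‖deriv f 0‖ / 96) ⊆ f '' ball 0 1 := by
  have hsub : closedBall (0:ℂ) (1/2) ⊆ ball 0 1 := closedBall_subset_ball (by norm_num)
  have hd : DifferentiableOn ℂ (deriv f) (ball 0 1) := hf.deriv isOpen_ball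
  obtain ⟨z₀, hz₀, hmax⟩ := (isCompact_closedBall (0:ℂ) (1/2)).exists_isMaxOn
    ⟨0, by simp⟩ (f := fun z => (1/2 - ‖z‖) * ‖deriv f z‖)
    ((continuousOn_const.sub continuousOn_id.norm).mul (hd.continuousOn.mono hsub).norm)
  set A := ‖deriv f z₀‖ with hA
  have h0' : 0 < ‖deriv f 0‖ := norm_pos_iff.2 h0
  have hmax0 : 1/2 * ‖deriv f 0‖ ≤ (1/2 - ‖z₀‖) * A := by
    simpa using hmax (show (0:ℂ) ∈ closedBall (0:ℂ) (1/2) by simp)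
  have hz₀' : ‖z₀‖ ≤ 1/2 := by simpa using hz₀
  have hApos : 0 < A := by
    rcases (norm_nonneg (deriv f z₀)).eq_or_lt with h | h
    · rw [hA, ← h, mul_zero] at hmax0; linarith
    · exact h
  have hlt : ‖z₀‖ < 1/2 := by
    rcases hz₀'.eq_or_lt with h | h
    · rw [h, sub_self, zero_mul] at hmax0; linarith
    · exact h
  set R := (1/2 - ‖z₀‖) / 2 with hR
  have hRpos : 0 < R := by rw [hR]; linarith
  have hnorm : ∀ z ∈ ball z₀ R, ‖z‖ ≤ 1/2 - R := fun z hz => by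
    have h1 : ‖z - z₀‖ < R := by simpa [dist_eq_norm] using hz
    have h2 : ‖z‖ ≤ ‖z₀‖ + ‖z - z₀‖ := by simpa using norm_add_le z₀ (z - z₀)
    linarith
  have hsub1 : ball z₀ R ⊆ ball 0 1 := fun z hz => by
    have := hnorm z hz
    simp only [mem_ball, dist_zero_right]; linarith
  have hder : ∀ z ∈ ball z₀ R, ‖deriv f z‖ ≤ 2 * A := fun z hz => by
    have h1 := hnorm z hz
    have h2 : (1/2 - ‖z‖) * ‖deriv f z‖ ≤ (1/2 - ‖z₀‖) * A :=
      hmax (show z ∈ closedBall (0:ℂ) (1/2) by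
        simp only [mem_closedBall, dist_zero_right]; linarith)
    have h3 : R * ‖deriv f z‖ ≤ (1/2 - ‖z‖) * ‖deriv f z‖ := by gcongr; linarith
    have h4 : R * ‖deriv f z‖ ≤ R * (2 * A) := by
      calc _ ≤ (1/2 - ‖z₀‖) * A := h3.trans h2
        _ = R * (2 * A) := by rw [hR]; ring
    exact le_of_mul_le_mul_left h4 hRpos
  have hschwarz : ∀ z ∈ ball z₀ R, ‖deriv f z - deriv f z₀‖ ≤ 3 * A / R * ‖z - z₀‖ := fun z hz => by
    rw [← dist_eq_norm, ← dist_eq_norm]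
    refine dist_le_div_mul_dist_of_mapsTo_ball (hd.mono hsub1) (fun y hy => ?_) hz
    rw [mem_closedBall, dist_eq_norm]
    calc _ ≤ ‖deriv f y‖ + ‖deriv f z₀‖ := norm_sub_le _ _
      _ ≤ 3 * A := by linarith [hder y hy]
  have hr6 : closedBall z₀ (R/6) ⊆ ball z₀ R := closedBall_subset_ball (by linarith)
  have hball : ∀ z ∈ sphere z₀ (R/6), A * R / 12 ≤ ‖f z - f z₀‖ := fun z hz => by
    have hzn : ‖z - z₀‖ = R/6 := by simpa [dist_eq_norm] using hz
    have hmv : ‖(f z - deriv f z₀ * z) - (f z₀ - deriv f z₀ * z₀)‖ ≤ A/2 * ‖z - z₀‖ := by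
      refine (convex_closedBall z₀ (R/6)).norm_image_sub_le_of_norm_hasDerivWithin_le
        (f := fun y => f y - deriv f z₀ * y) (f' := fun y => deriv f y - deriv f z₀)
        (fun y hy => ?_) (fun y hy => ?_) (mem_closedBall_self (by positivity))
        (sphere_subset_closedBall hz)
      · have h1 := (hf.differentiableAt (isOpen_ball.mem_nhds (hsub1 (hr6 hy)))).hasDerivAt
        have h2 := h1.sub ((hasDerivAt_id y).const_mul (deriv f z₀))
        simp only [mul_one] at h2
        exact h2.hasDerivWithinAt
      · have hyn : ‖y - z₀‖ ≤ R/6 := by simpa [dist_eq_norm] using hy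
        calc _ ≤ 3 * A / R * ‖y - z₀‖ := hschwarz y (hr6 hy)
          _ ≤ 3 * A / R * (R/6) := by gcongr
          _ = A/2 := by field_simp; ring
    have h3 : ‖deriv f z₀ * (z - z₀)‖ = A * (R/6) := by rw [norm_mul, hzn]
    have h4 : deriv f z₀ * (z - z₀) =
      (f z - f z₀) - ((f z - deriv f z₀ * z) - (f z₀ - deriv f z₀ * z₀)) := by ring
    have h5 := norm_sub_le (f z - f z₀) ((f z - deriv f z₀ * z) - (f z₀ - deriv f z₀ * z₀))
    rw [← h4, h3] at h5
    rw [hzn] at hmv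
    linarith
  have hmem₀ : z₀ ∈ ball (0:ℂ) 1 := hsub hz₀
  have hfreq : ∃ᶠ z in 𝓝 z₀, f z ≠ f z₀ := by
    intro h
    have h1 : f =ᶠ[𝓝 z₀] fun _ => f z₀ := h.mono fun z hz => not_not.1 hz
    have h2 : deriv f z₀ = 0 := by rw [h1.deriv_eq]; simp
    rw [hA, h2, norm_zero] at hApos
    exact lt_irrefl _ hApos
  have hdc : DiffContOnCl ℂ f (ball z₀ (R/6)) :=
    DifferentiableOn.diffContOnCl <| (hf.mono (hr6.trans hsub1)).mono
      (by rw [closure_ball _ (by positivity)])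
  refine ⟨f z₀, (ball_subset_ball ?_).trans
    ((hdc.ball_subset_image_closedBall (by positivity) hball hfreq).trans
      (image_mono (hr6.trans hsub1)))⟩
  have : (1/2 - ‖z₀‖) * A = 2 * (A * R) := by rw [hR]; ring
  linarith

theorem Real.cosh_add_two_le {t : ℝ} (ht : 0 ≤ t) :
    Real.cosh t + 2 ≤ Real.cosh (t + 2) := by
  have h1 : (1:ℝ) ≤ Real.cosh t := Real.one_le_cosh t
  have h2 : 0 ≤ Real.sinh t := Real.sinh_nonneg_iff.2 ht
  have h3 : 0 ≤ Real.sinh 2 := Real.sinh_nonneg_iff.2 (by norm_num)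
  have h4 : (3:ℝ) ≤ Real.cosh 2 := by
    have h5 : Real.cosh 2 = 2 * Real.cosh 1 ^ 2 - 1 := by
      have := Real.cosh_two_mul 1
      rw [mul_one] at this
      have h6 := Real.cosh_sq 1
      linarith
    have h7 : 1 + 1 ≤ Real.exp 1 := Real.add_one_le_exp 1
    have h8 : Real.sinh 1 ≥ 1 := by
      exact Real.self_le_sinh_iff.2 zero_le_one
    have := Real.cosh_sq 1
    nlinarith
  rw [Real.cosh_add]
  nlinarith [mul_nonneg h2 h3]

/-- The points at which `cosh` takes odd integer values form a `4`-net in `ℂ`. -/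
theorem Complex.exists_cosh_eq_odd (v : ℂ) :
    ∃ u : ℂ, ‖u - v‖ < 4 ∧ ∃ n : ℤ, cosh u = 2 * n + 1 := by
  obtain ⟨x, hx, k, hk⟩ : ∃ x : ℝ, |x - v.re| ≤ 2 ∧ ∃ k : ℤ, Real.cosh x = 2 * k + 1 := by
    have key : ∀ t : ℝ, 0 ≤ t → ∃ x : ℝ, |x - t| ≤ 2 ∧ ∃ k : ℤ, Real.cosh x = 2 * k + 1 := by
      intro t ht
      have h1 := Int.le_ceil ((Real.cosh t - 1) / 2)
      have h2 := Int.ceil_lt_add_one ((Real.cosh t - 1) / 2)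
      have h3 := Real.cosh_add_two_le ht
      obtain ⟨x, hx, hxe⟩ := intermediate_value_Icc (show t ≤ t + 2 by linarith)
        Real.continuous_cosh.continuousOn
        (show 2 * (⌈(Real.cosh t - 1) / 2⌉ : ℝ) + 1 ∈ Icc (Real.cosh t) (Real.cosh (t + 2)) from
          ⟨by linarith, by linarith⟩)
      exact ⟨x, by rw [abs_le]; constructor <;> linarith [hx.1, hx.2], _, hxe⟩
    rcases le_total 0 v.re with h | h
    · exact key _ h
    · obtain ⟨x, hx, k, hk⟩ := key (-v.re) (by linarith)
      refine ⟨-x, ?_, k, by rw [Real.cosh_neg, hk]⟩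
      rw [← abs_neg]; convert hx using 2; ring
  set m := round (v.im / Real.pi) with hm
  have hpi := Real.pi_pos
  have hy : |m * Real.pi - v.im| < 2 := by
    have h1 := abs_sub_round (v.im / Real.pi)
    have h2 : |m * Real.pi - v.im| = |v.im / Real.pi - m| * Real.pi := by
      rw [← abs_of_pos hpi, ← abs_mul, abs_of_pos hpi, ← abs_neg]
      congr 1; field_simp; ring
    rw [h2]
    have := Real.pi_lt_four
    calc _ ≤ 1/2 * Real.pi := by gcongr
      _ < 2 := by linarith
  refine ⟨x + (m * Real.pi : ℝ) * I, ?_, ?_⟩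
  · calc _ ≤ |(x + (m * Real.pi : ℝ) * I - v).re| + |(x + (m * Real.pi : ℝ) * I - v).im| :=
          norm_le_abs_re_add_abs_im _
      _ = |x - v.re| + |m * Real.pi - v.im| := by simp
      _ < 4 := by linarith
  · have hk' : (Complex.cosh x) = 2 * k + 1 := by exact_mod_cast congrArg ((↑) : ℝ → ℂ) hk
    have hs : Complex.sin (m * Real.pi) = 0 := Complex.sin_int_mul_pi m
    have hc : Complex.cos (m * Real.pi) = (-1) ^ m := by
      have h := congrArg ((↑) : ℝ → ℂ) (Real.cos_int_mul_pi m)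
      push_cast at h
      exact h
    have hcosh : Complex.cosh (x + (m * Real.pi : ℝ) * I) = (2 * k + 1) * (-1) ^ m := by
      rw [cosh_add, cosh_mul_I, sinh_mul_I, hk']
      push_cast
      rw [hs, hc]; ring
    rcases Int.even_or_odd m with h | h
    · exact ⟨k, by rw [hcosh, h.neg_one_zpow, mul_one]⟩
    · exact ⟨-k - 1, by rw [hcosh, h.neg_one_zpow]; push_cast; ring⟩

/-- A holomorphic function on the unit disk that omits the odd integers grows at most linearly. -/
theorem Complex.norm_deriv_le_of_omits_odd {w : ℂ → ℂ} (hw : DifferentiableOn ℂ w (ball 0 1))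
    (hodd : ∀ z ∈ ball (0:ℂ) 1, ∀ n : ℤ, w z ≠ 2 * n + 1) :
    ‖deriv w 0‖ ≤ 384 * (‖w 0‖ + 1) := by
  have hmem : (0:ℂ) ∈ ball (0:ℂ) 1 := mem_ball_self one_pos
  have hne : ∀ z ∈ ball (0:ℂ) 1, w z ^ 2 - 1 ≠ 0 := fun z hz h => by
    have h1 : (w z - 1) * (w z + 1) = 0 := by linear_combination h
    rcases mul_eq_zero.1 h1 with h2 | h2
    · exact hodd z hz 0 (by push_cast; linear_combination h2)
    · exact hodd z hz (-1) (by push_cast; linear_combination h2)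
  obtain ⟨ℓ, hℓ, -, hℓe⟩ := exists_log_of_differentiableOn_ball ((hw.pow 2).sub_const 1) hne one_pos
    (exp_log (hne 0 hmem))
  set s : ℂ → ℂ := fun z => exp (ℓ z / 2) with hs
  have hsd : DifferentiableOn ℂ s (ball 0 1) := (hℓ.div_const 2).cexp
  have hs2 : ∀ z ∈ ball (0:ℂ) 1, s z * s z = w z ^ 2 - 1 := fun z hz => by
    rw [hs, ← exp_add, add_halves]; exact hℓe z hz
  have hprod : ∀ z ∈ ball (0:ℂ) 1, (w z + s z) * (w z - s z) = 1 := fun z hz => by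
    linear_combination -hs2 z hz
  have hne' : ∀ z ∈ ball (0:ℂ) 1, w z + s z ≠ 0 := fun z hz h => by
    have := hprod z hz
    rw [h, zero_mul] at this
    exact zero_ne_one this
  obtain ⟨V, hV, -, hVe⟩ := exists_log_of_differentiableOn_ball (hw.add hsd) hne' one_pos
    (exp_log (hne' 0 hmem))
  have hcosh : ∀ z ∈ ball (0:ℂ) 1, cosh (V z) = w z := fun z hz => by
    have h1 : exp (V z) = w z + s z := hVe z hz
    have h2 : exp (-V z) = w z - s z := by
      rw [exp_neg, h1]
      exact inv_eq_of_mul_eq_one_right (hprod z hz)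
    rw [cosh, h1, h2]; ring
  have hV384 : ‖deriv V 0‖ ≤ 384 := by
    by_contra! hcon
    obtain ⟨v, hv⟩ := exists_ball_subset_image_of_differentiableOn_ball hV
      (norm_pos_iff.1 (by linarith))
    obtain ⟨u, hu, n, hn⟩ := exists_cosh_eq_odd v
    obtain ⟨z, hz, hzu⟩ := hv (show u ∈ ball v (‖deriv V 0‖ / 96) by
      rw [mem_ball, dist_eq_norm]; linarith)
    exact hodd z hz n (by rw [← hcosh z hz, hzu, hn])
  have hVd : HasDerivAt V (deriv V 0) 0 :=
    (hV.differentiableAt (isOpen_ball.mem_nhds hmem)).hasDerivAt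
  have hwd : HasDerivAt w (sinh (V 0) * deriv V 0) 0 :=
    hVd.ccosh.congr_of_eventuallyEq
      ((isOpen_ball.mem_nhds hmem : ball (0:ℂ) 1 ∈ 𝓝 0) |> fun h => by
        filter_upwards [h] with z hz using (hcosh z hz).symm)
  have hsinh : ‖sinh (V 0)‖ ≤ ‖w 0‖ + 1 := by
    have h1 : sinh (V 0) ^ 2 = w 0 ^ 2 - 1 := by
      rw [← hcosh 0 hmem]; linear_combination -cosh_sq (V 0)
    have h2 : ‖sinh (V 0)‖ ^ 2 ≤ ‖w 0‖ ^ 2 + 1 := by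
      rw [← norm_pow, h1, ← norm_pow]
      simpa only [norm_one] using norm_sub_le (w 0 ^ 2) 1
    refine le_of_sq_le_sq ?_ (by positivity)
    nlinarith [norm_nonneg (w 0)]
  rw [hwd.deriv, norm_mul, mul_comm]
  gcongr

/-- **Landau's theorem**, with an explicit constant. -/
theorem Complex.norm_deriv_le_of_omits_zero_one {f : ℂ → ℂ} (hf : DifferentiableOn ℂ f (ball 0 1))
    (h0 : ∀ z ∈ ball (0:ℂ) 1, f z ≠ 0) (h1 : ∀ z ∈ ball (0:ℂ) 1, f z ≠ 1) :
    ‖deriv f 0‖ ≤ 3840 * (‖f 0‖ * (1 + |Real.log ‖f 0‖|)) := by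
  have hmem : (0:ℂ) ∈ ball (0:ℂ) 1 := mem_ball_self one_pos
  obtain ⟨L, hL, hL0, hLe⟩ := exists_log_of_differentiableOn_ball hf h0 one_pos
    (exp_log (h0 0 hmem))
  have hpi : (Real.pi : ℂ) * I ≠ 0 := mul_ne_zero (by exact_mod_cast Real.pi_ne_zero) I_ne_zero
  have hbound := norm_deriv_le_of_omits_odd (w := fun z => L z / (Real.pi * I) + 1)
    ((hL.div_const _).add_const 1) fun z hz n hn => by
      have h2 : L z = n * (2 * Real.pi * I) := by
        have : L z / (Real.pi * I) = 2 * n := by linear_combination hn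
        rw [div_eq_iff hpi] at this
        rw [this]; ring
      exact h1 z hz (by rw [← hLe z hz, h2, exp_int_mul_two_pi_mul_I])
  have hLd : HasDerivAt L (deriv L 0) 0 :=
    (hL.differentiableAt (isOpen_ball.mem_nhds hmem)).hasDerivAt
  have hfd : HasDerivAt f (f 0 * deriv L 0) 0 := by
    rw [← hLe 0 hmem]
    exact hLd.cexp.congr_of_eventuallyEq (by
      filter_upwards [isOpen_ball.mem_nhds hmem] with z hz using (hLe z hz).symm)
  have hpin : ‖(Real.pi : ℂ) * I‖ = Real.pi := by simp [abs_of_pos Real.pi_pos]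
  rw [((hLd.div_const (Real.pi * I)).add_const 1).deriv, norm_div, hpin,
    div_le_iff₀ Real.pi_pos] at hbound
  have hL0n : ‖L 0‖ ≤ |Real.log ‖f 0‖| + Real.pi := by
    rw [hL0]
    calc _ ≤ |(log (f 0)).re| + |(log (f 0)).im| := norm_le_abs_re_add_abs_im _
      _ ≤ _ := by rw [log_re, log_im]; gcongr; exact abs_arg_le_pi _
  have hw0 : ‖L 0 / (Real.pi * I) + 1‖ * Real.pi ≤ ‖L 0‖ + Real.pi := by
    calc _ ≤ (‖L 0 / (Real.pi * I)‖ + 1) * Real.pi := by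
          have := norm_add_le (L 0 / (Real.pi * I)) 1
          rw [norm_one] at this
          gcongr
      _ = ‖L 0‖ + Real.pi := by
        rw [norm_div, hpin, add_mul, div_mul_cancel₀ _ Real.pi_ne_zero, one_mul]
  have hdL : ‖deriv L 0‖ ≤ 3840 * (1 + |Real.log ‖f 0‖|) := by
    have := abs_nonneg (Real.log ‖f 0‖)
    have := Real.pi_lt_d2
    linarith
  rw [hfd.deriv, norm_mul, mul_left_comm]
  gcongr

theorem Complex.norm_deriv_le_of_omits_two {f : ℂ → ℂ} {e e' : ℂ}
    (hf : DifferentiableOn ℂ f (ball 0 1)) (he : ∀ z ∈ ball (0:ℂ) 1, f z ≠ e)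
    (he' : ∀ z ∈ ball (0:ℂ) 1, f z ≠ e') (hne : e ≠ e') :
    ‖deriv f 0‖ ≤ 3840 * (‖f 0 - e‖ * (1 + |Real.log (‖f 0 - e‖ / ‖e' - e‖)|)) := by
  have hne' : e' - e ≠ 0 := sub_ne_zero.2 hne.symm
  have hpos : 0 < ‖e' - e‖ := norm_pos_iff.2 hne'
  have h := norm_deriv_le_of_omits_zero_one (f := fun z => (f z - e) / (e' - e))
    ((hf.sub_const e).div_const _) (fun z hz => div_ne_zero (sub_ne_zero.2 (he z hz)) hne')
    fun z hz h => he' z hz (by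
      rw [div_eq_one_iff_eq hne'] at h
      exact sub_left_injective h)
  have hfd : HasDerivAt f (deriv f 0) 0 :=
    (hf.differentiableAt (isOpen_ball.mem_nhds (mem_ball_self one_pos))).hasDerivAt
  rw [((hfd.sub_const e).div_const (e' - e)).deriv, norm_div, norm_div, div_le_iff₀ hpos] at h
  calc _ ≤ _ := h
    _ = _ := by field_simp

/-- The disk automorphism moving the origin to `a`. -/
def moebius (a z : ℂ) : ℂ := (z + a) / (1 + starRingEnd ℂ a * z)

theorem moebius_zero (a : ℂ) : moebius a 0 = a := by simp [moebius]

theorem moebius_neg_self (a : ℂ) : moebius (-a) a = 0 := by simp [moebius]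

theorem one_add_conj_mul_ne_zero {a z : ℂ} (ha : ‖a‖ < 1) (hz : ‖z‖ < 1) :
    1 + starRingEnd ℂ a * z ≠ 0 := fun h => by
  have h1 : starRingEnd ℂ a * z = -1 := by linear_combination h
  have h2 : ‖a‖ * ‖z‖ = 1 := by
    have := congrArg norm h1
    simpa using this
  nlinarith [norm_nonneg a, norm_nonneg z]

theorem norm_moebius_lt_one {a z : ℂ} (ha : ‖a‖ < 1) (hz : ‖z‖ < 1) : ‖moebius a z‖ < 1 := by
  have hne := one_add_conj_mul_ne_zero ha hz
  rw [moebius, norm_div, div_lt_one (norm_pos_iff.2 hne)]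
  refine lt_of_pow_lt_pow_left₀ 2 (norm_nonneg _) ?_
  have h1 : ‖1 + starRingEnd ℂ a * z‖ ^ 2 - ‖z + a‖ ^ 2 = (1 - ‖a‖ ^ 2) * (1 - ‖z‖ ^ 2) := by
    simp only [← normSq_eq_norm_sq, normSq_apply, add_re, add_im, mul_re, mul_im, conj_re, conj_im,
      one_re, one_im]
    ring
  have h2 : 0 < 1 - ‖a‖ ^ 2 := by nlinarith [norm_nonneg a]
  have h3 : 0 < 1 - ‖z‖ ^ 2 := by nlinarith [norm_nonneg z]
  nlinarith [mul_pos h2 h3]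

theorem hasDerivAt_moebius {a z : ℂ} (ha : ‖a‖ < 1) (hz : ‖z‖ < 1) :
    HasDerivAt (moebius a) ((1 - ‖a‖ ^ 2 : ℝ) / (1 + starRingEnd ℂ a * z) ^ 2) z := by
  have hne := one_add_conj_mul_ne_zero ha hz
  refine (((hasDerivAt_id z).add_const a).div
    (((hasDerivAt_id z).const_mul (starRingEnd ℂ a)).const_add 1) hne).congr_deriv ?_
  congr 1
  have : (starRingEnd ℂ a) * a = (‖a‖ ^ 2 : ℝ) := by
    rw [mul_comm, mul_conj, normSq_eq_norm_sq]
  push_cast at this ⊢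
  simp only [id]
  linear_combination -this

/-- The **Schwarz–Pick lemma** at the origin. -/
theorem Complex.norm_deriv_le_one_sub_sq {F : ℂ → ℂ} (hF : DifferentiableOn ℂ F (ball 0 1))
    (hmaps : MapsTo F (ball 0 1) (ball 0 1)) : ‖deriv F 0‖ ≤ 1 - ‖F 0‖ ^ 2 := by
  have hmem : (0:ℂ) ∈ ball (0:ℂ) 1 := mem_ball_self one_pos
  have hlt : ∀ z ∈ ball (0:ℂ) 1, ‖F z‖ < 1 := fun z hz => by simpa using hmaps hz
  have ha : ‖-F 0‖ < 1 := by simpa using hlt 0 hmem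
  have hpos : 0 < 1 - ‖F 0‖ ^ 2 := by
    have := hlt 0 hmem
    nlinarith [norm_nonneg (F 0)]
  have hderiv : ∀ z ∈ ball (0:ℂ) 1, HasDerivAt F (deriv F z) z := fun z hz =>
    (hF.differentiableAt (isOpen_ball.mem_nhds hz)).hasDerivAt
  have hcomp := fun z hz => (hasDerivAt_moebius ha (hlt z hz)).comp z (hderiv z hz)
  have h := norm_deriv_le_one_of_mapsTo_ball (f := moebius (-F 0) ∘ F) (c := 0) (R := 1)
    (fun z hz => (hcomp z hz).differentiableAt.differentiableWithinAt)
    (fun z hz => by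
      simpa [moebius_neg_self] using (norm_moebius_lt_one ha (hlt z hz)).le) one_pos
  rw [(hcomp 0 hmem).deriv] at h
  have h1 : 1 + starRingEnd ℂ (-F 0) * F 0 = (1 - ‖F 0‖ ^ 2 : ℝ) := by
    rw [map_neg, neg_mul, mul_comm, mul_conj, normSq_eq_norm_sq]
    push_cast; ring
  rw [h1, norm_neg, norm_mul, norm_div, norm_pow, norm_real, Real.norm_of_nonneg hpos.le,
    sq (1 - ‖F 0‖ ^ 2), div_mul_cancel_left₀ hpos.ne', inv_mul_le_iff₀ hpos, mul_one] at h
  exact h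

/-- Holomorphic maps from the disk lift through holomorphic covering maps without critical
points. -/
theorem IsCoveringMapOn.exists_holomorphic_lift {p f : ℂ → ℂ} {Ω : Set ℂ} {z₀ : ℂ}
    (hp : DifferentiableOn ℂ p (ball 0 1))
    (hcov : IsCoveringMapOn (fun z : ball (0:ℂ) 1 => p z) Ω)
    (hp' : ∀ z ∈ ball (0:ℂ) 1, deriv p z ≠ 0)
    (hf : DifferentiableOn ℂ f (ball 0 1)) (hfΩ : MapsTo f (ball 0 1) Ω)
    (hz₀ : z₀ ∈ ball (0:ℂ) 1) (h0 : p z₀ = f 0) :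
    ∃ F : ℂ → ℂ, DifferentiableOn ℂ F (ball 0 1) ∧ MapsTo F (ball 0 1) (ball 0 1) ∧
      F 0 = z₀ ∧ ∀ z ∈ ball (0:ℂ) 1, p (F z) = f z := by
  classical
  have hmem : (0:ℂ) ∈ ball (0:ℂ) 1 := mem_ball_self one_pos
  have : ContractibleSpace (ball (0:ℂ) 1) := (convex_ball 0 1).contractibleSpace ⟨0, hmem⟩
  have : LocallyPathConnectedSpace (ball (0:ℂ) 1) := isOpen_ball.locallyPathConnectedSpace
  obtain ⟨Φ, ⟨hΦ0, hΦ⟩, -⟩ := hcov.existsUnique_continuousMap_lifts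
    ⟨fun z : ball (0:ℂ) 1 => f z, continuousOn_iff_continuous_domRestrict.1 hf.continuousOn⟩
    (a₀ := ⟨0, hmem⟩) (e₀ := ⟨z₀, hz₀⟩) h0 fun z => hfΩ z.2
  set F : ℂ → ℂ := fun z => if hz : z ∈ ball (0:ℂ) 1 then (Φ ⟨z, hz⟩ : ℂ) else 0 with hF
  have hFeq : ∀ z : ball (0:ℂ) 1, F z = Φ z := fun z => by simp only [hF, dif_pos z.2]
  have hmaps : MapsTo F (ball 0 1) (ball 0 1) := fun z hz => by
    rw [hFeq ⟨z, hz⟩]; exact (Φ ⟨z, hz⟩).2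
  have hpF : ∀ z ∈ ball (0:ℂ) 1, p (F z) = f z := fun z hz => by
    rw [hFeq ⟨z, hz⟩]; exact congrFun hΦ ⟨z, hz⟩
  have hcont : ContinuousOn F (ball 0 1) := by
    rw [continuousOn_iff_continuous_domRestrict]
    exact (continuous_subtype_val.comp Φ.continuous).congr fun z => (hFeq z).symm
  refine ⟨F, fun z hz => ?_, hmaps, ?_, hpF⟩
  · have hs : HasStrictDerivAt p (deriv p (F z)) (F z) :=
      (hp.analyticAt (isOpen_ball.mem_nhds (hmaps hz))).hasStrictDerivAt
    have hinv := hs.to_localInverse (hp' _ (hmaps hz))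
    have hFz : ContinuousAt F z := hcont.continuousAt (isOpen_ball.mem_nhds hz)
    have heq : F =ᶠ[𝓝 z] fun y => hs.localInverse p _ _ (hp' _ (hmaps hz)) (f y) := by
      filter_upwards [isOpen_ball.mem_nhds hz,
        hFz.eventually (hs.eventually_left_inverse (hp' _ (hmaps hz)))] with y hy hy'
      rw [← hpF y hy, hy']
    rw [hpF z hz] at hinv
    exact ((hinv.hasDerivAt.differentiableAt.comp z
      (hf.differentiableAt (isOpen_ball.mem_nhds hz))).congr_of_eventuallyEq
        heq).differentiableWithinAt
  · rw [hFeq ⟨0, hmem⟩, hΦ0]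

section Poincare

variable {Ω : Set ℂ} {lam : ℂ → ℝ}

theorem deriv_ne_zero_of_mul_norm_deriv_eq {p : ℂ → ℂ}
    (hlam : ∀ z ∈ ball (0:ℂ) 1, lam (p z) * ‖deriv p z‖ = 2 / (1 - ‖z‖ ^ 2)) :
    ∀ z ∈ ball (0:ℂ) 1, deriv p z ≠ 0 := fun z hz h => by
  have hz1 : ‖z‖ < 1 := by simpa using hz
  have : 0 < 2 / (1 - ‖z‖ ^ 2) := div_pos two_pos (by nlinarith [norm_nonneg z])
  have h1 := hlam z hz
  rw [h, norm_zero, mul_zero] at h1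
  exact this.ne h1

/-- Holomorphic maps from the disk do not increase the Poincaré density. -/
theorem IsPoincareDensity.mul_norm_deriv_le (h : IsPoincareDensity Ω lam) {f : ℂ → ℂ}
    (hf : DifferentiableOn ℂ f (ball 0 1)) (hfΩ : MapsTo f (ball 0 1) Ω) :
    lam (f 0) * ‖deriv f 0‖ ≤ 2 := by
  obtain ⟨p, hd, himg, hcov, hlam⟩ := h
  have hp' := deriv_ne_zero_of_mul_norm_deriv_eq hlam
  have hmem : (0:ℂ) ∈ ball (0:ℂ) 1 := mem_ball_self one_pos
  have hp : DifferentiableOn ℂ p (ball 0 1) := fun z hz => (hd z hz).differentiableWithinAt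
  obtain ⟨z₀, hz₀, hpz₀⟩ : f 0 ∈ p '' ball (0:ℂ) 1 := himg ▸ hfΩ hmem
  obtain ⟨F, hF, hFmaps, hF0, hpF⟩ := hcov.exists_holomorphic_lift hp hp' hf hfΩ hz₀ hpz₀
  have hFd : HasDerivAt F (deriv F 0) 0 :=
    (hF.differentiableAt (isOpen_ball.mem_nhds hmem)).hasDerivAt
  have hfd : HasDerivAt f (deriv p (F 0) * deriv F 0) 0 :=
    ((hd _ (hFmaps hmem)).hasDerivAt.comp 0 hFd).congr_of_eventuallyEq (by
      filter_upwards [isOpen_ball.mem_nhds hmem] with z hz using (hpF z hz).symm)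
  have hlt : ‖F 0‖ < 1 := by simpa using hFmaps hmem
  have hpos : 0 < 1 - ‖F 0‖ ^ 2 := by nlinarith [norm_nonneg (F 0)]
  rw [hfd.deriv, norm_mul, ← mul_assoc, ← hpF 0 hmem, hlam _ (hFmaps hmem), div_mul_eq_mul_div,
    div_le_iff₀ hpos]
  linarith [norm_deriv_le_one_sub_sq hF hFmaps]

/-- The Poincaré density is realised by a holomorphic map from the disk. -/
theorem IsPoincareDensity.exists_mul_norm_deriv_eq (h : IsPoincareDensity Ω lam) {z : ℂ}
    (hz : z ∈ Ω) :
    ∃ f : ℂ → ℂ, DifferentiableOn ℂ f (ball 0 1) ∧ MapsTo f (ball 0 1) Ω ∧ f 0 = z ∧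
      lam z * ‖deriv f 0‖ = 2 := by
  obtain ⟨p, hd, rfl, -, hlam⟩ := h
  obtain ⟨a, ha, rfl⟩ := hz
  have ha1 : ‖a‖ < 1 := by simpa using ha
  have hpos : 0 < 1 - ‖a‖ ^ 2 := by nlinarith [norm_nonneg a]
  have hmaps : MapsTo (moebius a) (ball 0 1) (ball 0 1) := fun z hz => by
    simpa using norm_moebius_lt_one ha1 (by simpa using hz)
  have hder : ∀ z ∈ ball (0:ℂ) 1, HasDerivAt (p ∘ moebius a)
      (deriv p (moebius a z) * ((1 - ‖a‖ ^ 2 : ℝ) / (1 + starRingEnd ℂ a * z) ^ 2)) z :=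
    fun z hz => (hd _ (hmaps hz)).hasDerivAt.comp z (hasDerivAt_moebius ha1 (by simpa using hz))
  refine ⟨p ∘ moebius a, fun z hz => (hder z hz).differentiableAt.differentiableWithinAt,
    fun z hz => mem_image_of_mem p (hmaps hz), by simp [moebius_zero], ?_⟩
  rw [(hder 0 (mem_ball_self one_pos)).deriv, moebius_zero, norm_mul, ← mul_assoc, hlam a ha,
    mul_zero, add_zero, one_pow, div_one, norm_real, Real.norm_of_nonneg hpos.le,
    div_mul_cancel₀ _ hpos.ne']

theorem IsPoincareDensity.pos (h : IsPoincareDensity Ω lam) {z : ℂ} (hz : z ∈ Ω) : 0 < lam z := by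
  obtain ⟨f, -, -, -, hf⟩ := h.exists_mul_norm_deriv_eq hz
  exact pos_of_mul_pos_left (hf ▸ two_pos) (norm_nonneg _)

theorem IsPoincareDensity.continuousOn (h : IsPoincareDensity Ω lam) : ContinuousOn lam Ω := by
  obtain ⟨p, hd, rfl, -, hlam⟩ := h
  have hp' := deriv_ne_zero_of_mul_norm_deriv_eq hlam
  have hp : DifferentiableOn ℂ p (ball 0 1) := fun z hz => (hd z hz).differentiableWithinAt
  rintro _ ⟨a, ha, rfl⟩
  have hs : HasStrictDerivAt p (deriv p a) a :=
    (hp.analyticAt (isOpen_ball.mem_nhds ha)).hasStrictDerivAt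
  set g := hs.localInverse p _ _ (hp' a ha) with hg
  have hgc : ContinuousAt g (p a) := (hs.to_localInverse (hp' a ha)).hasDerivAt.continuousAt
  have hga : g (p a) = a := (hs.eventually_left_inverse (hp' a ha)).self_of_nhds
  have ha1 : ‖a‖ < 1 := by simpa using ha
  have hpos : 0 < 1 - ‖a‖ ^ 2 := by nlinarith [norm_nonneg a]
  have hc : ContinuousAt (fun z => 2 / (1 - ‖z‖ ^ 2) / ‖deriv p z‖) a :=
    (continuousAt_const.div (continuousAt_const.sub (continuousAt_id.norm.pow 2)) hpos.ne').div
      ((hp.deriv isOpen_ball).continuousOn.continuousAt (isOpen_ball.mem_nhds ha)).norm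
      (norm_ne_zero_iff.2 (hp' a ha))
  rw [← hga] at hc
  refine ((hc.comp hgc).congr ?_).continuousWithinAt
  filter_upwards [hs.eventually_right_inverse (hp' a ha),
    hgc.eventually (by rw [hga]; exact isOpen_ball.mem_nhds ha)] with y hy hyb
  have := hlam (g y) hyb
  rw [hy] at this
  simp only [Function.comp_apply]
  rw [← this, mul_div_cancel_right₀ _ (norm_ne_zero_iff.2 (hp' _ hyb))]

/-- The Poincaré density of a domain symmetric in the real axis is symmetric. -/
theorem IsPoincareDensity.conj (h : IsPoincareDensity Ω lam)
    (hΩ : ∀ z ∈ Ω, (starRingEnd ℂ) z ∈ Ω) {z : ℂ} (hz : z ∈ Ω) :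
    lam ((starRingEnd ℂ) z) = lam z := by
  have key : ∀ z ∈ Ω, lam ((starRingEnd ℂ) z) ≤ lam z := fun z hz => by
    obtain ⟨f, hf, hfΩ, rfl, hfl⟩ := h.exists_mul_norm_deriv_eq hz
    have hmem : (0:ℂ) ∈ ball (0:ℂ) 1 := mem_ball_self one_pos
    have hconj : ∀ {w : ℂ}, w ∈ ball (0:ℂ) 1 → (starRingEnd ℂ) w ∈ ball (0:ℂ) 1 := fun hw => by
      simpa using hw
    have hder : ∀ w ∈ ball (0:ℂ) 1, HasDerivAt (starRingEnd ℂ ∘ f ∘ starRingEnd ℂ)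
        (starRingEnd ℂ (deriv f (starRingEnd ℂ w))) w := fun w hw => by
      have := (hf.differentiableAt (isOpen_ball.mem_nhds (hconj hw))).hasDerivAt.conj_conj
      rwa [conj_conj] at this
    have hle := h.mul_norm_deriv_le (f := starRingEnd ℂ ∘ f ∘ starRingEnd ℂ)
      (fun w hw => (hder w hw).differentiableAt.differentiableWithinAt)
      (fun w hw => hΩ _ (hfΩ (hconj hw)))
    rw [(hder 0 hmem).deriv, ← hfl] at hle
    simp only [Function.comp_apply, map_zero, RCLike.norm_conj] at hle
    refine le_of_mul_le_mul_right hle ?_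
    exact pos_of_mul_pos_right (hfl ▸ two_pos) (h.pos hz).le
  refine le_antisymm (key z hz) ?_
  simpa using key _ (hΩ z hz)

/-- The Poincaré density of a plane domain satisfies Landau's lower estimate. -/
theorem IsPoincareDensity.isLandauDensity (h : IsPoincareDensity Ω lam) (ho : IsOpen Ω)
    (hc : IsPreconnected Ω) (hne : Ωᶜ.Nonempty) : IsLandauDensity Ω lam (2 / 3840) where
  admissible := ⟨ho, hc, h.continuousOn, fun _ hz => h.pos hz⟩
  const_pos := by norm_num
  mul_infDist_le z hz := by
    set δ := infDist z Ωᶜ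
    have hδ : 0 ≤ δ := infDist_nonneg
    have hder : ∀ ζ : ℂ, HasDerivAt (fun ζ => z + δ * ζ) (δ : ℂ) ζ := fun ζ => by
      simpa using ((hasDerivAt_id ζ).const_mul (δ : ℂ)).const_add z
    have hle := h.mul_norm_deriv_le (f := fun ζ => z + δ * ζ)
      (fun ζ _ => (hder ζ).differentiableAt.differentiableWithinAt) fun ζ hζ => by
        by_contra hcon
        have h1 : δ ≤ dist z (z + δ * ζ) := infDist_le_dist_of_mem hcon
        have h2 : ‖ζ‖ < 1 := by simpa using hζ
        have h3 : dist z (z + δ * ζ) = δ * ‖ζ‖ := by simp [abs_of_nonneg hδ]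
        have h4 : 0 < δ := (ho.isClosed_compl.notMem_iff_infDist_pos hne).1 (not_not.2 hz)
        nlinarith
    rw [(hder 0).deriv] at hle
    simpa [abs_of_nonneg hδ] using hle
  le_mul z hz e he e' he' hee' := by
    obtain ⟨f, hf, hfΩ, rfl, hfl⟩ := h.exists_mul_norm_deriv_eq hz
    have hL := norm_deriv_le_of_omits_two (e := e) (e' := e') hf (fun w hw hwe => he (hwe ▸ hfΩ hw))
      (fun w hw hwe => he' (hwe ▸ hfΩ hw)) hee'
    have := mul_le_mul_of_nonneg_left hL (h.pos hz).le
    rw [hfl] at this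
    linarith

end Poincare

end

noncomputable section

/-- Theorem 4.6: if the gaps satisfy `bₙ - aₙ ≤ aₙ·G(aₙ)` with `G(x) → 0` as `x → ∞`, and
`limsup aₙ = ∞`, then neither the Poincaré nor the quasihyperbolic metric of `Ω` is Gromov
hyperbolic. -/
theorem denjoy_not_hyperbolic_of_small_gaps
    (Ω : Set ℂ) (a b : ℕ → ℝ) (G : ℝ → ℝ)
    (hΩ : IsDenjoyDomain Ω)
    (hab : ∀ n, a n < b n)
    (hdisj : Pairwise (Function.onFun Disjoint fun n => Ioo (a n) (b n)))
    (hre : (fun x : ℝ => (x : ℂ)) ⁻¹' Ω = ⋃ n, Ioo (a n) (b n))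
    (hlimsup : ∀ M : ℝ, ∃ᶠ n in Filter.atTop, M < a n)
    (hGpos : ∀ x : ℝ, 0 < x → 0 < G x)
    (hG0 : Filter.Tendsto G Filter.atTop (nhds 0))
    (hgap : ∀ n, 0 < a n → b n - a n ≤ a n * G (a n)) :
    ¬ IsGromovHyperbolic Ω (qhDist Ω) ∧
      ∀ lam : ℂ → ℝ, IsPoincareDensity Ω lam →
        ¬ IsGromovHyperbolic Ω (densityDist Ω lam) := by
  obtain ⟨n₀, -⟩ := (hlimsup 0).exists
  have hreal : ∀ e ∈ Ωᶜ, e.im = 0 :=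
    hΩ.im_eq_zero_of_mem_compl (x := (a n₀ + b n₀) / 2) <| by
      have : (a n₀ + b n₀) / 2 ∈ ⋃ n, Ioo (a n) (b n) :=
        mem_iUnion.2 ⟨n₀, by constructor <;> linarith [hab n₀]⟩
      rwa [← hre] at this
  have hne : Ωᶜ.Nonempty := ⟨_, ofReal_left_mem_compl hab hdisj hre n₀⟩
  have hconn : IsPreconnected Ω := hΩ.2.1.isPreconnected
  have hsymm : ∀ z ∈ Ω, (starRingEnd ℂ) z ∈ Ω := fun z hz => by
    by_contra hcon
    have h0 := hreal _ hcon
    rw [conj_im, neg_eq_zero] at h0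
    exact hcon (by rwa [conj_of_im_eq_zero h0])
  exact ⟨(isLandauDensity_qhDensity hΩ.1 hconn hne).not_isGromovHyperbolic_of_small_gaps
      (fun z _ => qhDensity_conj hreal z) hΩ hab hdisj hre hlimsup hG0 hgap,
    fun lam hlam => (hlam.isLandauDensity hΩ.1 hconn hne).not_isGromovHyperbolic_of_small_gaps
      (fun z hz => hlam.conj hsymm hz) hΩ hab hdisj hre hlimsup hG0 hgap⟩

end
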